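/- For every prime number n ≥ 7, there exist coprime integers k ≥ 2 and l ≥ 3 with k + l = n such that: (a) every regular language L over an alphabet of size 2 with sc(L) ≤ n satisfies sc(root(L)) ≤ |U_{k,l}| − n(n−1)/2; and (b) there exists a regular language L over an alphabet of size 2 with sc(L) ≤ n and sc(root(L)) = |U_{k,l}| − n(n−1)/2. -/

import Mathlib

/-- `root L` = words some positive power of which lies in `L`. -/
def root {A : Type} (L : Language A) : Language A :=
  {w | ∃ m : ℕ, 1 ≤ m ∧ (List.replicate m w).flatten ∈ L}

/-- A language is regular if some DFA with finitely many states recognizes it. -/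
def IsReg {A : Type} (L : Language A) : Prop :=
  ∃ (σ : Type) (_ : Fintype σ) (M : DFA A σ), M.accepts = L

/-- The state complexity of a language: the least number of states of a DFA recognizing it. -/
noncomputable def sc {A : Type} (L : Language A) : ℕ :=
  sInf {m | ∃ (σ : Type) (_ : Fintype σ) (M : DFA A σ), M.accepts = L ∧ Fintype.card σ = m}

/-- The submonoid of transformations of `Fin n` generated by `X`:
all finite compositions of elements of `X` (including the identity). -/
def MGen {n : ℕ} (X : Set (Fin n → Fin n)) : Set (Fin n → Fin n) :=
  {f | ∃ l : List (Fin n → Fin n), (∀ g ∈ l, g ∈ X) ∧ f = l.foldr (· ∘ ·) id}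

/-- The rank of a transformation: the number of elements of its image. -/
def rank {n : ℕ} (f : Fin n → Fin n) : ℕ := (Finset.image f Finset.univ).card

/-- The permutation of `Z_n = {1,…,n}` (coded as `Fin n`, with `i : Fin n` standing for
`i+1 ∈ Z_n`) with cycle decomposition `(1 2 ⋯ k)(k+1 k+2 ⋯ n)`. -/
def twoCycle (n k : ℕ) (i : Fin n) : Fin n :=
  ⟨(if i.val + 1 = k then 0 else if i.val + 1 = n then k else i.val + 1) % n,
    Nat.mod_lt _ i.pos⟩

/-- The set `U_{k,l} ⊆ T_n` (with `l = n - k`): all `γ` such that exactly one of the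
following holds: (1) `γ = α^m` for some `m ≥ 1`, where `α = (1 ⋯ k)(k+1 ⋯ n)`;
(2) `γ(i) = γ(j)` for some `i ∈ {1,…,k}`, `j ∈ {k+1,…,n}`, and some
`m ∈ {k+1,…,n}` is not in the image of `γ`. -/
def Ukl (n k : ℕ) : Set (Fin n → Fin n) :=
  {γ | Xor'
    (∃ m : ℕ, 1 ≤ m ∧ γ = (twoCycle n k)^[m])
    ((∃ i j : Fin n, i.val < k ∧ k ≤ j.val ∧ γ i = γ j) ∧
      ∃ m : Fin n, k ≤ m.val ∧ m ∉ Set.range γ)}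


namespace Cor

/-- transformation induced by a word -/
def tr {n : ℕ} (φ : Fin 2 → Fin n → Fin n) (w : List (Fin 2)) : Fin n → Fin n :=
  fun q => w.foldl (fun q a => φ a q) q

/-- acceptance of a transformation -/
def acc {n : ℕ} (z : Fin n) (F : Set (Fin n)) (f : Fin n → Fin n) : Prop :=
  ∃ m : ℕ, 1 ≤ m ∧ f^[m] z ∈ F

/-- strong equivalence -/
def EQ {n : ℕ} (z : Fin n) (F : Set (Fin n)) (f g : Fin n → Fin n) : Prop :=
  ∀ h : Fin n → Fin n, acc z F (h ∘ f) ↔ acc z F (h ∘ g)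

lemma tr_append {n : ℕ} (φ : Fin 2 → Fin n → Fin n) (w v : List (Fin 2)) :
    tr φ (w ++ v) = tr φ v ∘ tr φ w := by
  funext q; simp [tr, List.foldl_append]

lemma tr_replicate {n : ℕ} (φ : Fin 2 → Fin n → Fin n) (w : List (Fin 2)) (m : ℕ) :
    tr φ (List.replicate m w).flatten = (tr φ w)^[m] := by
  induction m with
  | zero => funext q; simp [tr]
  | succ m ih => rw [List.replicate_succ, List.flatten_cons, tr_append, ih, Function.iterate_succ]

lemma mem_root {n : ℕ} (M : DFA (Fin 2) (Fin n)) (w : List (Fin 2)) :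
    w ∈ root M.accepts ↔ acc M.start M.accept (tr (fun a q => M.step q a) w) := by
  have h : ∀ v : List (Fin 2), v ∈ M.accepts ↔ tr (fun a q => M.step q a) v M.start ∈ M.accept := by
    intro v; rfl
  constructor
  · rintro ⟨m, hm, h1⟩
    rw [h, tr_replicate] at h1
    exact ⟨m, hm, h1⟩
  · rintro ⟨m, hm, h1⟩
    refine ⟨m, hm, ?_⟩
    rw [h, tr_replicate]
    exact h1

lemma sc_le_of_dfa {A : Type} {σ : Type} [Fintype σ] (M : DFA A σ) : sc M.accepts ≤ Fintype.card σ :=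
  Nat.sInf_le ⟨σ, _, M, rfl, rfl⟩

lemma sc_spec {A : Type} (L : Language A) (h : IsReg L) :
    ∃ (σ : Type) (_ : Fintype σ) (M : DFA A σ), M.accepts = L ∧ Fintype.card σ = sc L := by
  obtain ⟨σ, i, M, hM⟩ := h
  exact Nat.sInf_mem (s := {m | ∃ (σ : Type) (_ : Fintype σ) (M : DFA A σ), M.accepts = L ∧ Fintype.card σ = m})
    ⟨_, σ, i, M, hM, rfl⟩

lemma exists_dfa {n : ℕ} (L : Language (Fin 2)) (h : IsReg L) (hn : sc L ≤ n) :
    ∃ M : DFA (Fin 2) (Fin n), M.accepts = L := by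
  obtain ⟨σ, _, M, hM, hc⟩ := sc_spec L h
  have : Fintype.card σ ≤ Fintype.card (Fin n) := by simpa using hc.trans_le hn
  obtain ⟨e⟩ := Function.Embedding.nonempty_of_card_le this
  have : Nonempty σ := ⟨M.start⟩
  let inv := Function.invFun e
  have hinv : ∀ x, inv (e x) = x := Function.leftInverse_invFun e.injective
  let N : DFA (Fin 2) (Fin n) :=
    { step := fun q a => e (M.step (inv q) a), start := e M.start, accept := {q | inv q ∈ M.accept} }
  refine ⟨N, ?_⟩
  rw [← hM]
  have key : ∀ (w : List (Fin 2)) (s : σ), N.evalFrom (e s) w = e (M.evalFrom s w) := by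
    intro w
    induction w with
    | nil => intro s; rfl
    | cons a w ih =>
      intro s
      have : N.step (e s) a = e (M.step s a) := by simp [N, hinv]
      rw [DFA.evalFrom_cons, DFA.evalFrom_cons, this, ih]
  ext w
  rw [DFA.mem_accepts, DFA.mem_accepts]
  have := key w M.start
  change inv (N.evalFrom (e M.start) w) ∈ M.accept ↔ _
  rw [this, hinv]; rfl

lemma sc_root_le {n : ℕ} (M : DFA (Fin 2) (Fin n)) (W : Finset (Fin n → Fin n))
    (hW : ∀ w, ∃ g ∈ W, EQ M.start M.accept (tr (fun a q => M.step q a) w) g) :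
    sc (root M.accepts) ≤ W.card ∧ IsReg (root M.accepts) := by
  classical
  set φ : Fin 2 → Fin n → Fin n := fun a q => M.step q a with hφ
  let Q : (Fin n → Fin n) → Language (Fin 2) := fun f => {v | acc M.start M.accept (tr φ v ∘ f)}
  have hQ : ∀ w, (root M.accepts).leftQuotient w = Q (tr φ w) := by
    intro w
    ext v
    rw [Language.mem_leftQuotient, mem_root, tr_append]
    rfl
  have hsub : Set.range (root M.accepts).leftQuotient ⊆ (W.image Q : Finset _) := by
    rintro _ ⟨w, rfl⟩
    obtain ⟨g, hg, he⟩ := hW w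
    simp only [Finset.coe_image, Set.mem_image, Finset.mem_coe]
    refine ⟨g, hg, ?_⟩
    rw [hQ]
    ext v
    exact (he (tr φ v)).symm
  have hfin : (Set.range (root M.accepts).leftQuotient).Finite := Set.Finite.subset (Finset.finite_toSet _) hsub
  have := hfin.fintype
  -- move to universe 0 type : it's already in Type
  have h1 := sc_le_of_dfa (root M.accepts).toDFA
  rw [Language.accepts_toDFA] at h1
  refine ⟨h1.trans ?_, ⟨_, hfin.fintype, (root M.accepts).toDFA, Language.accepts_toDFA _⟩⟩
  rw [← Set.toFinset_card]
  calc _ ≤ (W.image Q).card := Finset.card_le_card (by intro x hx; rw [Set.mem_toFinset] at hx; exact hsub hx)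
    _ ≤ _ := Finset.card_image_le

lemma sc_root_ge {n : ℕ} (M : DFA (Fin 2) (Fin n)) (R : Finset (Fin n → Fin n))
    (hr : ∀ f ∈ R, ∃ w, tr (fun a q => M.step q a) w = f)
    (hd : ∀ f ∈ R, ∀ g ∈ R, f ≠ g → ∃ v, ¬ (acc M.start M.accept (tr (fun a q => M.step q a) v ∘ f) ↔
      acc M.start M.accept (tr (fun a q => M.step q a) v ∘ g))) :
    R.card ≤ sc (root M.accepts) := by
  classical
  have hreg := (sc_root_le M Finset.univ (fun w => ⟨_, Finset.mem_univ _, fun h => Iff.rfl⟩)).2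
  obtain ⟨σ, _, N, hN, hc⟩ := sc_spec _ hreg
  rw [← hc]
  choose! wd hwd using hr
  rw [← Finset.card_univ]
  apply Finset.card_le_card_of_injOn (fun f => N.eval (wd f)) (fun _ _ => Finset.mem_univ _)
  intro f hf g hg hfg
  by_contra hne
  obtain ⟨v, hv⟩ := hd f hf g hg hne
  apply hv
  rw [← hwd f hf, ← hwd g hg, ← tr_append, ← tr_append, ← mem_root, ← mem_root, ← hN,
    DFA.mem_accepts, DFA.mem_accepts]
  have hfg' : N.eval (wd f) = N.eval (wd g) := hfg
  simp only [DFA.eval, DFA.evalFrom_of_append] at hfg' ⊢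
  rw [hfg']

end Cor

namespace Cor

/-- `z ↦ i`, everything else to `j` -/
def sing {n : ℕ} (z i j : Fin n) : Fin n → Fin n := fun x => if x = z then i else j

lemma acc_sing {n : ℕ} (z : Fin n) (F : Set (Fin n)) (hz : z ∈ F) (a b : Fin n) :
    acc z F (sing z a b) ↔ (a ∈ F ∨ b ∈ F) := by
  constructor
  · rintro ⟨m, hm, h⟩
    obtain ⟨m, rfl⟩ : ∃ k, m = k + 1 := ⟨m - 1, by omega⟩
    rw [Function.iterate_succ_apply'] at h
    unfold sing at h
    split_ifs at h
    · exact Or.inl h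
    · exact Or.inr h
  · rintro (h | h)
    · exact ⟨1, le_rfl, by simpa [sing] using h⟩
    · by_cases ha : a = z
      · exact ⟨1, le_rfl, by simpa [sing, ha] using hz⟩
      · exact ⟨2, by norm_num, by simpa [sing, ha] using h⟩

lemma comp_sing {n : ℕ} (h : Fin n → Fin n) (z i j : Fin n) : h ∘ sing z i j = sing z (h i) (h j) := by
  funext x; simp only [sing, Function.comp]; split_ifs <;> rfl

lemma EQ_sing {n : ℕ} (z : Fin n) (F : Set (Fin n)) (hz : z ∈ F) (i j : Fin n) :
    EQ z F (sing z i j) (sing z j i) := by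
  intro h
  rw [comp_sing, comp_sing, acc_sing z F hz, acc_sing z F hz]
  exact or_comm

lemma acc_sing2 {n : ℕ} (z : Fin n) (F : Set (Fin n)) (hz : z ∉ F) (x : Fin n) (hx : x ∈ F) (a b : Fin n) :
    acc z F (sing x b a) ↔ a ∈ F := by
  have hzx : z ≠ x := fun h => hz (h ▸ hx)
  constructor
  · rintro ⟨m, hm, h⟩
    by_contra ha
    have hax : a ≠ x := fun h => ha (h ▸ hx)
    obtain ⟨m, rfl⟩ : ∃ k, m = k + 1 := ⟨m - 1, by omega⟩
    have : ∀ m, (sing x b a)^[m + 1] z = a := by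
      intro m
      induction m with
      | zero => simp [sing, hzx]
      | succ m ih => rw [Function.iterate_succ_apply', ih]; simp [sing, hax]
    rw [this] at h
    exact ha h
  · intro h
    exact ⟨1, le_rfl, by simpa [sing, hzx] using h⟩

lemma EQ_sing2 {n : ℕ} (z : Fin n) (F : Set (Fin n)) (hz : z ∉ F) (x : Fin n) (hx : x ∈ F) (i j : Fin n) :
    EQ z F (sing x j i) (sing x i i) := by
  intro h
  rw [comp_sing, comp_sing, acc_sing2 z F hz x hx, acc_sing2 z F hz x hx]

/-- abstract version of the non-permutation part of `U_{k,l}` -/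
def V {n : ℕ} (A : Finset (Fin n)) : Finset (Fin n → Fin n) := by
  classical
  exact Finset.univ.filter fun γ => (∃ i ∈ A, ∃ j ∉ A, γ i = γ j) ∧ ∃ m ∉ A, ∀ x, γ x ≠ m

lemma mem_V {n : ℕ} (A : Finset (Fin n)) (γ : Fin n → Fin n) :
    γ ∈ V A ↔ (∃ i ∈ A, ∃ j ∉ A, γ i = γ j) ∧ ∃ m ∉ A, ∀ x, γ x ≠ m := by
  classical
  simp [V]

lemma sing_mem_V {n : ℕ} (A : Finset (Fin n)) (h2 : 2 ≤ A.card) (h3 : A.card + 3 ≤ n) (z i j : Fin n) :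
    sing z i j ∈ V A := by
  classical
  rw [mem_V]
  have hc : Aᶜ.card = n - A.card := by rw [Finset.card_compl, Fintype.card_fin]
  constructor
  · obtain ⟨a, ha, haz⟩ := Finset.exists_mem_ne (by omega : 1 < A.card) z
    obtain ⟨b, hb, hbz⟩ := Finset.exists_mem_ne (by omega : 1 < Aᶜ.card) z
    refine ⟨a, ha, b, by simpa using hb, ?_⟩
    simp [sing, haz, hbz]
  · have : ((Aᶜ).erase i).erase j ≠ ∅ := by
      intro h
      have h1 := Finset.pred_card_le_card_erase (s := Aᶜ) (a := i)
      have h2 := Finset.pred_card_le_card_erase (s := (Aᶜ).erase i) (a := j)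
      rw [h] at h2
      simp at h2
      omega
    obtain ⟨m, hm⟩ := Finset.nonempty_iff_ne_empty.mpr this
    simp only [Finset.mem_erase, Finset.mem_compl] at hm
    refine ⟨m, hm.2.2, fun x => ?_⟩
    unfold sing
    split_ifs
    · exact fun h => hm.2.1 h.symm
    · exact fun h => hm.1 h.symm

/-- pairs -/
def prs (n : ℕ) : Finset (Fin n × Fin n) := Finset.univ.filter fun p => p.1 < p.2

lemma card_prs (n : ℕ) : (prs n).card = n * (n - 1) / 2 := by
  have h1 : (prs n).card = (Finset.univ.filter fun p : Fin n × Fin n => p.2 < p.1).card := by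
    apply Finset.card_bij (fun p _ => p.swap)
    · intro p hp; simpa [prs] using hp
    · intro p _ q _ h; exact Prod.swap_injective h
    · intro p hp; exact ⟨p.swap, by simpa [prs] using hp, by simp⟩
  have h2 : (prs n) ∪ (Finset.univ.filter fun p : Fin n × Fin n => p.2 < p.1) = Finset.univ.offDiag := by
    ext p
    simp only [prs, Finset.mem_union, Finset.mem_filter, Finset.mem_univ, true_and, Finset.mem_offDiag]
    exact lt_or_lt_iff_ne
  have h3 : Disjoint (prs n) (Finset.univ.filter fun p : Fin n × Fin n => p.2 < p.1) := by
    rw [Finset.disjoint_left]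
    intro p hp hq
    simp only [prs, Finset.mem_filter, Finset.mem_univ, true_and] at hp hq
    exact lt_asymm hp hq
  have h4 := Finset.card_union_of_disjoint h3
  rw [h2, Finset.offDiag_card, ← h1] at h4
  simp only [Finset.card_univ, Fintype.card_fin] at h4
  have : n * n - n = n * (n - 1) := by rw [Nat.mul_sub, mul_one]
  omega

lemma sing_inj {n : ℕ} (hn : 2 ≤ n) (z i j i' j' : Fin n) (h : sing z i j = sing z i' j') : i = i' ∧ j = j' := by
  constructor
  · simpa [sing] using congrFun h z
  · have : Nontrivial (Fin n) := Fin.nontrivial_iff_two_le.mpr hn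
    obtain ⟨y, hy⟩ := exists_ne z
    simpa [sing, hy] using congrFun h y

lemma reduce {n : ℕ} (hn : 2 ≤ n) (U : Finset (Fin n → Fin n)) (hU : ∀ z i j, sing z i j ∈ U)
    (z : Fin n) (F : Set (Fin n)) :
    ∃ W : Finset (Fin n → Fin n), W.card + n * (n - 1) / 2 ≤ U.card ∧ ∀ f ∈ U, ∃ g ∈ W, EQ z F f g := by
  classical
  have main : ∀ y : Fin n, (∀ i j : Fin n, i < j → ∃ i' j', ¬ i' < j' ∧ EQ z F (sing y i j) (sing y i' j')) →
      ∃ W : Finset (Fin n → Fin n), W.card + n * (n - 1) / 2 ≤ U.card ∧ ∀ f ∈ U, ∃ g ∈ W, EQ z F f g := by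
    intro y hy
    let S := (prs n).image fun p => sing y p.1 p.2
    have hS : S.card = n * (n - 1) / 2 := by
      rw [← card_prs]
      apply Finset.card_image_of_injective
      intro p q h
      obtain ⟨h1, h2⟩ := sing_inj hn _ _ _ _ _ h
      exact Prod.ext h1 h2
    have hSU : S ⊆ U := by
      intro f hf
      obtain ⟨p, _, rfl⟩ := Finset.mem_image.mp hf
      exact hU _ _ _
    refine ⟨U \ S, ?_, ?_⟩
    · rw [Finset.card_sdiff_of_subset hSU, hS]
      have := Finset.card_le_card hSU
      omega
    · intro f hf
      by_cases hfS : f ∈ S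
      · obtain ⟨p, hp, rfl⟩ := Finset.mem_image.mp hfS
        obtain ⟨i', j', hij, he⟩ := hy p.1 p.2 (by simpa [prs] using hp)
        refine ⟨sing y i' j', ?_, he⟩
        rw [Finset.mem_sdiff]
        refine ⟨hU _ _ _, fun h => ?_⟩
        obtain ⟨q, hq, hq2⟩ := Finset.mem_image.mp h
        obtain ⟨h1, h2⟩ := sing_inj hn _ _ _ _ _ hq2
        apply hij
        rw [← h1, ← h2]
        simpa [prs] using hq
      · exact ⟨f, Finset.mem_sdiff.mpr ⟨hf, hfS⟩, fun h => Iff.rfl⟩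
  rcases F.eq_empty_or_nonempty with hF | ⟨x, hx⟩
  · refine main z fun i j hij => ⟨j, i, lt_asymm hij, fun h => ?_⟩
    subst hF
    constructor <;> rintro ⟨m, _, h⟩ <;> exact h.elim
  by_cases hz : z ∈ F
  · exact main z fun i j hij => ⟨j, i, lt_asymm hij, EQ_sing z F hz i j⟩
  · exact main x fun i j hij => ⟨j, j, lt_irrefl _, EQ_sing2 z F hz x hx j i⟩

/-- distinguishing lemma -/
lemma disting {n : ℕ} (z : Fin n) (f g : Fin n → Fin n) (hfg : f ≠ g)
    (hne : ∀ i j, ¬ (f = sing z i j ∧ g = sing z j i)) :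
    ∃ y a b, ¬ (acc z {z} (sing y a b ∘ f) ↔ acc z {z} (sing y a b ∘ g)) := by
  have fix : ∀ (f : Fin n → Fin n) (w : Fin n), w ≠ z → f z = w → f w = w → ¬ acc z {z} f := by
    rintro f w hw h1 h2 ⟨m, hm, h⟩
    obtain ⟨m, rfl⟩ : ∃ k, m = k + 1 := ⟨m - 1, by omega⟩
    have : ∀ m, f^[m + 1] z = w := by
      intro m
      induction m with
      | zero => simpa using h1
      | succ m ih => rw [Function.iterate_succ_apply', ih, h2]
    rw [this] at h
    exact hw h
  have case1 : ∀ (f g : Fin n → Fin n) (w : Fin n), f z ≠ g z → w ≠ z → g w ≠ f z →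
      acc z {z} (sing (f z) z w ∘ f) ∧ ¬ acc z {z} (sing (f z) z w ∘ g) := by
    intro f g w h1 h2 h3
    refine ⟨⟨1, le_rfl, by simp [sing]⟩, fix _ w h2 ?_ ?_⟩
    · simp [sing, h1.symm]
    · simp [sing, h3]
  have case2 : ∀ (f g : Fin n → Fin n) (u : Fin n), f z = g z → u ≠ z → f u ≠ g u → f u ≠ f z →
      acc z {z} (sing (f u) z u ∘ f) ∧ ¬ acc z {z} (sing (f u) z u ∘ g) := by
    intro f g u h1 h2 h3 h4
    refine ⟨⟨2, by norm_num, by simp [sing, h4.symm]⟩, fix _ u h2 ?_ ?_⟩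
    · simp [sing, ← h1, h4.symm]
    · simp [sing, h3.symm]
  by_cases hz : f z = g z
  · obtain ⟨u, hu⟩ := Function.ne_iff.mp hfg
    have huz : u ≠ z := by rintro rfl; exact hu hz
    by_cases h : f u = f z
    · obtain ⟨h1, h2⟩ := case2 g f u hz.symm huz (Ne.symm hu) (by rw [← hz, ← h]; exact Ne.symm hu)
      exact ⟨_, _, _, fun h => h2 (h.mpr h1)⟩
    · obtain ⟨h1, h2⟩ := case2 f g u hz huz hu h
      exact ⟨_, _, _, fun h => h2 (h.mp h1)⟩
  · by_cases hw : ∃ w, w ≠ z ∧ g w ≠ f z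
    · obtain ⟨w, h1, h2⟩ := hw
      obtain ⟨h1, h2⟩ := case1 f g w hz h1 h2
      exact ⟨_, _, _, fun h => h2 (h.mp h1)⟩
    · by_cases hw' : ∃ w, w ≠ z ∧ f w ≠ g z
      · obtain ⟨w, h1, h2⟩ := hw'
        obtain ⟨h1, h2⟩ := case1 g f w (Ne.symm hz) h1 h2
        exact ⟨_, _, _, fun h => h2 (h.mpr h1)⟩
      · push Not at hw hw'
        exfalso
        apply hne (f z) (g z)
        constructor
        · funext x
          by_cases hx : x = z
          · simp [sing, hx]
          · simp [sing, hx, hw' x hx]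
        · funext x
          by_cases hx : x = z
          · simp [sing, hx]
          · simp [sing, hx, hw x hx]

end Cor

namespace Cor

/-- initial segment -/
def Ak (n k : ℕ) : Finset (Fin n) := Finset.univ.filter fun i => i.val < k

lemma mem_Ak {n k : ℕ} (i : Fin n) : i ∈ Ak n k ↔ i.val < k := by simp [Ak]

lemma card_Ak {n k : ℕ} (h : k ≤ n) : (Ak n k).card = k := by
  have : (Ak n k).card = (Finset.range k).card := by
    apply Finset.card_bij (fun i _ => i.val)
    · intro i hi; simpa [Ak] using hi
    · intro i _ j _ h; exact Fin.ext h
    · intro m hm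
      exact ⟨⟨m, by simp at hm; omega⟩, by simpa [Ak] using hm, rfl⟩
  simpa using this

lemma mod_succ_eq {k a : ℕ} (hk : 0 < k) : (a + 1) % k = if a % k + 1 = k then 0 else a % k + 1 := by
  have h := Nat.mod_lt a hk
  rw [Nat.add_mod]
  split_ifs with h1
  · rcases Nat.lt_or_ge 1 k with hk1 | hk1
    · rw [Nat.mod_eq_of_lt hk1, h1, Nat.mod_self]
    · have : k = 1 := by omega
      subst this; simp [Nat.mod_one]
  · rw [Nat.mod_eq_of_lt (by omega : 1 < k), Nat.mod_eq_of_lt (by omega)]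

lemma twoCycle_iter_lt {n k : ℕ} (hkn : k < n) (i : Fin n) (hi : i.val < k) (m : ℕ) :
    ((twoCycle n k)^[m] i).val = (i.val + m) % k := by
  have hk : 0 < k := by omega
  induction m with
  | zero => simp [Nat.mod_eq_of_lt hi]
  | succ m ih =>
    rw [Function.iterate_succ_apply']
    set j := (twoCycle n k)^[m] i
    have hj : j.val < k := by rw [ih]; exact Nat.mod_lt _ hk
    rw [← add_assoc, mod_succ_eq hk, ← ih]
    simp only [twoCycle]
    split_ifs with h1 h2
    · simp
    · omega
    · exact Nat.mod_eq_of_lt (by omega)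

lemma twoCycle_iter_ge {n k : ℕ} (hk : 0 < k) (hkn : k < n) (i : Fin n) (hi : k ≤ i.val) (m : ℕ) :
    ((twoCycle n k)^[m] i).val = k + (i.val - k + m) % (n - k) := by
  have hl : 0 < n - k := by omega
  induction m with
  | zero =>
    have := i.isLt
    simp only [Function.iterate_zero, id, add_zero]
    rw [Nat.mod_eq_of_lt (by omega)]; omega
  | succ m ih =>
    rw [Function.iterate_succ_apply']
    set j := (twoCycle n k)^[m] i
    have hj := Nat.mod_lt (i.val - k + m) hl
    rw [← add_assoc, mod_succ_eq hl]
    simp only [twoCycle]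
    generalize (i.val - k + m) % (n - k) = r at *
    split_ifs with h1 h2
    all_goals first | omega | (rw [Nat.mod_eq_of_lt (by omega)]; omega)

lemma twoCycle_trans {n k : ℕ} (hk : 0 < k) (hkn : k < n) (hco : Nat.Coprime k (n - k))
    (i i' j j' : Fin n) (hi : i.val < k) (hi' : i'.val < k) (hj : k ≤ j.val) (hj' : k ≤ j'.val) :
    ∃ m, 1 ≤ m ∧ (twoCycle n k)^[m] i = i' ∧ (twoCycle n k)^[m] j = j' := by
  obtain ⟨m, h1, h2⟩ := Nat.chineseRemainder hco (i'.val + k - i.val) (j'.val - k + (n - k) - (j.val - k))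
  have hjn := j.isLt
  have hjn' := j'.isLt
  have hmod1 : i.val + m ≡ i'.val [MOD k] := by
    calc i.val + m ≡ i.val + (i'.val + k - i.val) [MOD k] := Nat.ModEq.add_left _ h1
      _ = i'.val + k := by omega
      _ ≡ i'.val [MOD k] := by simp [Nat.ModEq]
  have hmod2 : (j.val - k) + m ≡ j'.val - k [MOD (n - k)] := by
    calc (j.val - k) + m ≡ (j.val - k) + (j'.val - k + (n - k) - (j.val - k)) [MOD (n - k)] := Nat.ModEq.add_left _ h2
      _ = (j'.val - k) + (n - k) := by omega
      _ ≡ j'.val - k [MOD (n - k)] := by simp [Nat.ModEq]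
  refine ⟨m + k * (n - k), ?_, ?_, ?_⟩
  · have : 0 < k * (n - k) := Nat.mul_pos hk (by omega)
    omega
  · apply Fin.ext
    rw [twoCycle_iter_lt hkn i hi, ← add_assoc, Nat.add_mul_mod_self_left, hmod1, Nat.mod_eq_of_lt hi']
  · apply Fin.ext
    rw [twoCycle_iter_ge hk hkn j hj, ← add_assoc, Nat.add_mul_mod_self_right, hmod2, Nat.mod_eq_of_lt (by omega)]
    omega

/-- powers of a map -/
noncomputable def pows {n : ℕ} (α : Fin n → Fin n) : Finset (Fin n → Fin n) := by
  classical
  exact Finset.univ.filter fun γ => ∃ m : ℕ, 1 ≤ m ∧ γ = α^[m]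

lemma mem_pows {n : ℕ} (α γ : Fin n → Fin n) : γ ∈ pows α ↔ ∃ m : ℕ, 1 ≤ m ∧ γ = α^[m] := by
  classical
  simp [pows]

lemma twoCycle_inj {n k : ℕ} (hk : 0 < k) (hkn : k < n) : Function.Injective (twoCycle n k) := by
  intro i j h
  have := congrArg Fin.val h
  simp only [twoCycle] at this
  have hi := i.isLt
  have hj := j.isLt
  apply Fin.ext
  rw [Nat.mod_eq_of_lt (by split_ifs <;> omega), Nat.mod_eq_of_lt (by split_ifs <;> omega)] at this
  split_ifs at this <;> omega

lemma card_pows_ge {n k : ℕ} (hk : 0 < k) (hkn : k < n) (hco : Nat.Coprime k (n - k)) :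
    k * (n - k) ≤ (pows (twoCycle n k)).card := by
  classical
  let i0 : Fin n := ⟨0, by omega⟩
  let j0 : Fin n := ⟨k, hkn⟩
  have h1 : (Ak n k ×ˢ (Ak n k)ᶜ).card = k * (n - k) := by
    rw [Finset.card_product, Finset.card_compl, card_Ak hkn.le, Fintype.card_fin]
  rw [← h1]
  refine le_trans (Finset.card_le_card ?_) (Finset.card_image_le (f := fun γ : Fin n → Fin n => (γ i0, γ j0)))
  rintro ⟨i, j⟩ hij
  simp only [Finset.mem_product, Finset.mem_compl, mem_Ak, not_lt] at hij
  obtain ⟨m, hm, h2, h3⟩ := twoCycle_trans hk hkn hco i0 i j0 j hk hij.1 le_rfl hij.2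
  rw [Finset.mem_image]
  exact ⟨_, (mem_pows _ _).mpr ⟨m, hm, rfl⟩, by rw [h2, h3]⟩

lemma Ukl_eq {n k : ℕ} (hk : 0 < k) (hkn : k < n) :
    Ukl n k = ((V (Ak n k) ∪ pows (twoCycle n k) : Finset (Fin n → Fin n)) : Set (Fin n → Fin n)) := by
  classical
  ext γ
  have hdis : (∃ m : ℕ, 1 ≤ m ∧ γ = (twoCycle n k)^[m]) → ¬ (∃ i j : Fin n, i.val < k ∧ k ≤ j.val ∧ γ i = γ j) := by
    rintro ⟨m, _, rfl⟩ ⟨i, j, hi, hj, h⟩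
    have := (twoCycle_inj hk hkn).iterate m h
    subst this
    omega
  have e2 : ((∃ i j : Fin n, i.val < k ∧ k ≤ j.val ∧ γ i = γ j) ∧ ∃ m : Fin n, k ≤ m.val ∧ m ∉ Set.range γ) ↔ γ ∈ V (Ak n k) := by
    rw [mem_V]
    simp only [mem_Ak, not_lt, Set.mem_range, not_exists]
    constructor
    · rintro ⟨⟨i, j, h1, h2, h3⟩, h4⟩
      exact ⟨⟨i, h1, j, h2, h3⟩, h4⟩
    · rintro ⟨⟨i, h1, j, h2, h3⟩, h4⟩
      exact ⟨⟨i, j, h1, h2, h3⟩, h4⟩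
  simp only [Finset.coe_union, Set.mem_union, Finset.mem_coe, mem_pows]
  rw [← e2]
  have hdis' : (∃ m : ℕ, 1 ≤ m ∧ γ = (twoCycle n k)^[m]) → ¬ ((∃ i j : Fin n, i.val < k ∧ k ≤ j.val ∧ γ i = γ j) ∧
      ∃ m : Fin n, k ≤ m.val ∧ m ∉ Set.range γ) := fun h h2 => hdis h h2.1
  constructor
  · rintro (⟨h, _⟩ | ⟨h, _⟩)
    · exact Or.inr h
    · exact Or.inl h
  · rintro (h | h)
    · exact Or.inr ⟨h, fun h' => hdis' h' h⟩
    · exact Or.inl ⟨h, hdis' h⟩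

lemma Ukl_ncard {n k : ℕ} (hk : 0 < k) (hkn : k < n) :
    (Ukl n k).ncard = (V (Ak n k)).card + (pows (twoCycle n k)).card := by
  classical
  rw [Ukl_eq hk hkn, Set.ncard_coe_finset, Finset.card_union_of_disjoint]
  rw [Finset.disjoint_left]
  intro γ h1 h2
  rw [mem_V] at h1
  rw [mem_pows] at h2
  obtain ⟨⟨i, hi, j, hj, h⟩, _⟩ := h1
  obtain ⟨m, _, rfl⟩ := h2
  have := (twoCycle_inj hk hkn).iterate m h
  subst this
  exact hj hi

lemma card_V_congr {n : ℕ} (A A' : Finset (Fin n)) (h : A.card = A'.card) : (V A).card ≤ (V A').card := by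
  classical
  have e : {x // x ∈ A} ≃ {x // x ∈ A'} := Fintype.equivOfCardEq (by simpa using h)
  let E : Equiv.Perm (Fin n) := e.extendSubtype
  have hE1 : ∀ x ∈ A, E x ∈ A' := fun x hx => e.extendSubtype_mem x hx
  have hE2 : ∀ x ∉ A, E x ∉ A' := fun x hx => e.extendSubtype_not_mem x hx
  apply Finset.card_le_card_of_injOn (fun γ => E ∘ γ ∘ E.symm)
  · intro γ hγ
    rw [Finset.mem_coe, mem_V] at hγ
    obtain ⟨⟨i, hi, j, hj, h⟩, m, hm, h2⟩ := hγ
    rw [Finset.mem_coe, mem_V]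
    refine ⟨⟨E i, hE1 i hi, E j, hE2 j hj, by simp [h]⟩, E m, hE2 m hm, fun x => ?_⟩
    simpa using h2 _
  · intro γ _ γ' _ h
    funext x
    have := congrFun h (E x)
    simpa using this

lemma card_pows_le {n : ℕ} (α : Equiv.Perm (Fin n)) (A : Finset (Fin n)) (i j : Fin n)
    (hi : ∀ x, x ∈ A ↔ α.SameCycle i x) (hj : ∀ x, x ∉ A ↔ α.SameCycle j x) :
    (pows α).card ≤ A.card * (n - A.card) := by
  classical
  have h1 : (A ×ˢ Aᶜ).card = A.card * (n - A.card) := by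
    rw [Finset.card_product, Finset.card_compl, Fintype.card_fin]
  rw [← h1]
  apply Finset.card_le_card_of_injOn (fun γ => (γ i, γ j))
  · intro γ hγ
    rw [Finset.mem_coe, mem_pows] at hγ
    obtain ⟨m, _, rfl⟩ := hγ
    simp only [Finset.coe_product, Set.mem_prod, Finset.mem_coe, Finset.mem_compl]
    rw [hi, hj]
    constructor
    · exact ⟨m, by simp [Equiv.Perm.iterate_eq_pow]⟩
    · exact ⟨m, by simp [Equiv.Perm.iterate_eq_pow]⟩
  · intro γ hγ γ' hγ' h
    rw [Finset.mem_coe, mem_pows] at hγ hγ'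
    obtain ⟨m, _, rfl⟩ := hγ
    obtain ⟨m', _, rfl⟩ := hγ'
    simp only [Prod.mk.injEq, Equiv.Perm.iterate_eq_pow] at h
    have key : ∀ y x, α.SameCycle y x → (α ^ m) y = (α ^ m') y → (α ^ m) x = (α ^ m') x := by
      rintro y x ⟨s, rfl⟩ h
      rw [← Equiv.Perm.mul_apply, ← Equiv.Perm.mul_apply, ← zpow_natCast, ← zpow_natCast, ← zpow_add, ← zpow_add,
        add_comm, add_comm (m' : ℤ), zpow_add, zpow_add, Equiv.Perm.mul_apply, Equiv.Perm.mul_apply,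
        zpow_natCast, zpow_natCast, h]
    funext x
    rw [Equiv.Perm.iterate_eq_pow, Equiv.Perm.iterate_eq_pow]
    by_cases hx : x ∈ A
    · exact key i x ((hi x).mp hx) h.1
    · exact key j x ((hj x).mp hx) h.2

end Cor

namespace Cor

open Equiv Equiv.Perm in
lemma swaps_of_star {n : ℕ} (H : Subgroup (Perm (Fin n))) (b c : Fin n)
    (h : ∀ x, x ≠ b → swap x c ∈ H) (x y : Fin n) (hx : x ≠ b) (hy : y ≠ b) : swap x y ∈ H := by
  by_cases hxy : x = y
  · subst hxy; rw [swap_self]; exact H.one_mem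
  by_cases hyc : y = c
  · subst hyc; exact h x hx
  by_cases hxc : x = c
  · subst hxc; rw [swap_comm]; exact h y hy
  have : swap x y = swap x c * swap y c * swap x c := by
    have := swap_mul_swap_mul_swap (x := y) (y := c) (z := x) hyc (Ne.symm hxy)
    rw [swap_comm x c, this, swap_comm]
  rw [this]
  exact H.mul_mem (H.mul_mem (h x hx) (h y hy)) (h x hx)

open Equiv Equiv.Perm in
lemma swap_conj_mem {n : ℕ} (H : Subgroup (Perm (Fin n))) (g : Perm (Fin n)) (hg : g ∈ H) (x y : Fin n)
    (h : swap x y ∈ H) : swap (g x) (g y) ∈ H := by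
  have : swap (g x) (g y) = g * swap x y * g⁻¹ := by
    rw [mul_swap_eq_swap_mul]; simp
  rw [this]
  exact H.mul_mem (H.mul_mem hg h) (H.inv_mem hg)

open Equiv Equiv.Perm in
lemma exists_pi {n : ℕ} (A : Finset (Fin n)) (hA2 : 2 ≤ A.card) (hA3 : A.card + 3 ≤ n) (b : Fin n) (hb : b ∉ A) :
    ∃ π : Perm (Fin n), π b = b ∧ ∀ H : Subgroup (Perm (Fin n)),
      (∀ i ∈ A, ∀ i' ∈ A, ∃ ρ ∈ H, ρ i = i' ∧ ∀ j ∉ A, ρ j = j) → π ∈ H →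
      ∀ x y, x ≠ b → y ≠ b → swap x y ∈ H := by
  classical
  have hc : Aᶜ.card = n - A.card := by rw [Finset.card_compl, Fintype.card_fin]
  by_cases h2 : A.card = 2
  · obtain ⟨q, p, hqp, hA⟩ := Finset.card_eq_two.mp h2
    obtain ⟨π, hπ, hs⟩ := Finset.exists_cycleOn (insert p (Aᶜ.erase b))
    have hfix : ∀ x, x ∉ insert p (Aᶜ.erase b) → π x = x := by
      intro x hx
      by_contra h
      exact hx (hs (mem_support.mpr h))
    have hqA : q ∈ A := by rw [hA]; simp
    have hpA : p ∈ A := by rw [hA]; simp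
    have hbp : b ≠ p := fun h => hb (h ▸ hpA)
    refine ⟨π, hfix b (by simp [hbp]), fun H hH hπH => ?_⟩
    have hq : π q = q := hfix q (by simp [hqp, hqA])
    apply swaps_of_star H b q
    intro x hx
    have hpq : swap p q ∈ H := by
      obtain ⟨ρ, hρ, h1, h3⟩ := hH p hpA q hqA
      have : ρ = swap p q := by
        have hρq : ρ q = p := by
          by_contra hne
          have hq2 : ρ q ≠ q := by
            intro h; exact hqp (ρ.injective (h.trans h1.symm))
          have : ρ q ∉ A := by rw [hA]; simp [hne, hq2]
          have := h3 _ this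
          have := ρ.injective this
          exact hq2 this
        ext x
        by_cases hxp : x = p
        · subst hxp; rw [h1, swap_apply_left]
        · by_cases hxq : x = q
          · subst hxq; rw [hρq, swap_apply_right]
          · rw [swap_apply_of_ne_of_ne hxp hxq, h3 x (by rw [hA]; simp [hxp, hxq])]
      rw [← this]; exact hρ
    by_cases hxq : x = q
    · subst hxq; rw [swap_self]; exact H.one_mem
    · have hxT : x ∈ insert p (Aᶜ.erase b) := by
        by_cases hxp : x = p
        · simp [hxp]
        · have : x ∉ A := by rw [hA]; simp [hxp, hxq]
          simp [this, hx]
      obtain ⟨s, hs⟩ := hπ.2 (by simp : p ∈ ((insert p (Aᶜ.erase b) : Finset (Fin n)) : Set (Fin n))) (Finset.mem_coe.mpr hxT)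
      have h4 := swap_conj_mem H (π ^ s) (H.zpow_mem hπH s) p q hpq
      rw [hs, zpow_apply_eq_self_of_apply_eq_self hq] at h4
      exact h4
  · have h3 : 2 < A.card := by omega
    obtain ⟨q, hq, p, hp, r, hr, hqp, hqr, hpr⟩ := Finset.two_lt_card.mp h3
    obtain ⟨c, hcA, hcb⟩ := Finset.exists_mem_ne (by omega : 1 < Aᶜ.card) b
    rw [Finset.mem_compl] at hcA
    let T0 := (Aᶜ.erase b).erase c
    have hT : ∃ T : Finset (Fin n), Odd T.card ∧ T0 ⊆ T ∧ p ∈ T ∧ q ∉ T ∧ b ∉ T ∧ c ∉ T := by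
      have hcp : c ≠ p := fun h => hcA (h ▸ hp)
      have hcr : c ≠ r := fun h => hcA (h ▸ hr)
      have hbp : b ≠ p := fun h => hb (h ▸ hp)
      have hbr : b ≠ r := fun h => hb (h ▸ hr)
      have e1 : (insert p T0).card = T0.card + 1 := Finset.card_insert_of_notMem (by simp [T0, hp])
      have e2 : (insert r (insert p T0)).card = T0.card + 2 := by
        rw [Finset.card_insert_of_notMem (by simp [T0, hr, hpr.symm]), e1]
      rcases Nat.even_or_odd T0.card with he | ho
      · refine ⟨insert p T0, ?_, ?_, ?_, ?_, ?_, ?_⟩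
        · rw [e1]; exact he.add_one
        · exact Finset.subset_insert _ _
        · simp
        · simp [T0, hqp, hq]
        · simp [T0, hbp]
        · simp [T0, hcp]
      · refine ⟨insert r (insert p T0), ?_, ?_, ?_, ?_, ?_, ?_⟩
        · rw [e2]; exact ho.add_even even_two
        · exact (Finset.subset_insert _ _).trans (Finset.subset_insert _ _)
        · simp
        · simp [T0, hqp, hq, hqr]
        · simp [T0, hbp, hbr]
        · simp [T0, hcp, hcr]
    obtain ⟨T, hodd, hT0, hpT, hqT, hbT, hcT⟩ := hT
    obtain ⟨ζ, hζ, hs⟩ := Finset.exists_cycleOn T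
    have hfix : ∀ x, x ∉ T → ζ x = x := by
      intro x hx
      by_contra h
      exact hx (hs (mem_support.mpr h))
    have hqb : q ≠ b := fun h => hb (h ▸ hq)
    have hqc : q ≠ c := fun h => hcA (h ▸ hq)
    refine ⟨swap q c * ζ, ?_, fun H hH hπH => ?_⟩
    · rw [Perm.mul_apply, hfix b hbT, swap_apply_of_ne_of_ne hqb.symm hcb.symm]
    have hζT : ζ ^ T.card = 1 := by
      ext x
      by_cases hx : x ∈ T
      · rw [hζ.pow_card_apply hx]; rfl
      · rw [pow_apply_eq_self_of_apply_eq_self (hfix x hx)]; rfl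
    have hcomm : Commute (swap q c) ζ := by
      apply Equiv.Perm.Disjoint.commute
      intro x
      by_cases hx : x ∈ T
      · left
        exact swap_apply_of_ne_of_ne (fun h => hqT (h ▸ hx)) (fun h => hcT (h ▸ hx))
      · right; exact hfix x hx
    have hsw : swap q c ∈ H := by
      have h5 := H.pow_mem hπH T.card
      rw [hcomm.mul_pow, hζT, mul_one] at h5
      obtain ⟨t, ht⟩ := hodd
      rw [ht, pow_add, pow_mul, pow_two, swap_mul_self, one_pow, one_mul, pow_one] at h5
      exact h5
    have hζH : ζ ∈ H := by
      have := H.mul_mem hsw hπH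
      rwa [← mul_assoc, swap_mul_self, one_mul] at this
    apply swaps_of_star H b c
    have hAc : ∀ x ∈ A, swap x c ∈ H := by
      intro x hx
      obtain ⟨ρ, hρ, h1, h2⟩ := hH q hq x hx
      have := swap_conj_mem H ρ hρ q c hsw
      rwa [h1, h2 c hcA] at this
    intro x hx
    by_cases hxA : x ∈ A
    · exact hAc x hxA
    by_cases hxc : x = c
    · subst hxc; rw [swap_self]; exact H.one_mem
    have hxT : x ∈ T := hT0 (by simp [T0, hxA, hxc, hx])
    obtain ⟨s, hs⟩ := hζ.2 (Finset.mem_coe.mpr hpT) (Finset.mem_coe.mpr hxT)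
    have h4 := swap_conj_mem H (ζ ^ s) (H.zpow_mem hζH s) p c (hAc p hp)
    rw [hs, zpow_apply_eq_self_of_apply_eq_self (hfix c hcT)] at h4
    exact h4

/-- merge `j` into `i` -/
def mrg {n : ℕ} (i j : Fin n) : Fin n → Fin n := fun x => if x = j then i else x

lemma exists_perm3 {n : ℕ} (u v j x y z : Fin n) (h1 : u ≠ v) (h2 : u ≠ j) (h3 : v ≠ j)
    (h4 : x ≠ y) (h5 : x ≠ z) (h6 : y ≠ z) : ∃ τ : Equiv.Perm (Fin n), τ u = x ∧ τ v = y ∧ τ j = z := by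
  classical
  let f : Fin 3 → Fin n := ![u, v, j]
  let g : Fin 3 → Fin n := ![x, y, z]
  have hf : Function.Injective f := by
    intro a b; fin_cases a <;> fin_cases b <;> simp [f, h1, h2, h3, h1.symm, h2.symm, h3.symm]
  have hg : Function.Injective g := by
    intro a b; fin_cases a <;> fin_cases b <;> simp [g, h4, h5, h6, h4.symm, h5.symm, h6.symm]
  let e : {x // x ∈ Set.range f} ≃ {x // x ∈ Set.range g} :=
    (Equiv.ofInjective f hf).symm.trans (Equiv.ofInjective g hg)
  have he : ∀ t, e.extendSubtype (f t) = g t := by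
    intro t
    rw [Equiv.extendSubtype_apply_of_mem e (f t) ⟨t, rfl⟩]
    have : (Equiv.ofInjective f hf).symm ⟨f t, ⟨t, rfl⟩⟩ = t := by
      rw [Equiv.symm_apply_eq]; rfl
    simp only [e, Equiv.trans_apply]
    rw [this]; rfl
  exact ⟨e.extendSubtype, he 0, he 1, he 2⟩

open Equiv Equiv.Perm in
lemma gen {n : ℕ} (A : Finset (Fin n)) (hA2 : 2 ≤ A.card) (hA3 : A.card + 3 ≤ n) (α : Perm (Fin n))
    (htr : ∀ i ∈ A, ∀ i' ∈ A, ∀ j ∉ A, ∀ j' ∉ A, ∃ m : ℕ, (α ^ m) i = i' ∧ (α ^ m) j = j') :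
    ∃ β : Fin n → Fin n, ∀ M : Set (Fin n → Fin n), (∀ f ∈ M, ∀ g ∈ M, f ∘ g ∈ M) → (α : Fin n → Fin n) ∈ M →
      β ∈ M → id ∈ M → ∀ γ ∈ V A, γ ∈ M := by
  classical
  have hc : Aᶜ.card = n - A.card := by rw [Finset.card_compl, Fintype.card_fin]
  obtain ⟨a, ha⟩ := Finset.card_pos.mp (by omega : 0 < A.card)
  obtain ⟨b, hb⟩ := Finset.card_pos.mp (by omega : 0 < Aᶜ.card)
  rw [Finset.mem_compl] at hb
  have hab : a ≠ b := fun h => hb (h ▸ ha)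
  obtain ⟨π, hπb, hπ⟩ := exists_pi A hA2 hA3 b hb
  refine ⟨π ∘ mrg a b, fun M hM hα hβ hid => ?_⟩
  have hpow : ∀ m : ℕ, ((α ^ m : Perm (Fin n)) : Fin n → Fin n) ∈ M := by
    intro m
    induction m with
    | zero => exact hid
    | succ m ih => rw [pow_succ, coe_mul]; exact hM _ ih _ hα
  have hinv : ∀ m : ℕ, (((α ^ m)⁻¹ : Perm (Fin n)) : Fin n → Fin n) ∈ M := by
    intro m
    have : (α ^ m)⁻¹ ∈ Submonoid.powers α := by
      rw [mem_powers_iff_mem_zpowers]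
      exact Subgroup.inv_mem _ (Subgroup.pow_mem _ (Subgroup.mem_zpowers α) m)
    obtain ⟨t, ht⟩ := this
    have ht' : α ^ t = (α ^ m)⁻¹ := ht
    rw [← ht']; exact hpow t
  let P : Perm (Fin n) → Prop := fun g => g b = b ∧ (g ∘ mrg a b) ∈ M
  have Pmul : ∀ g h, P g → P h → P (g * h) := by
    rintro g h ⟨hg1, hg2⟩ ⟨hh1, hh2⟩
    refine ⟨by rw [Perm.mul_apply, hh1, hg1], ?_⟩
    have : (g * h : Perm (Fin n)) ∘ mrg a b = (g ∘ mrg a b) ∘ (h ∘ mrg a b) := by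
      funext x
      have hx : h (mrg a b x) ≠ b := by
        intro h1
        have := h.injective (h1.trans hh1.symm)
        unfold mrg at this
        split_ifs at this with h5
        · exact hab this
        · exact h5 this
      simp only [Function.comp, Perm.mul_apply]
      congr 1
      conv_rhs => unfold mrg
      rw [if_neg]
      · rfl
      · exact hx
    rw [this]
    exact hM _ hg2 _ hh2
  have Ppow : ∀ g, P g → ∀ m : ℕ, P (g ^ (m + 1)) := by
    intro g hg m
    induction m with
    | zero => simpa using hg
    | succ m ih => rw [pow_succ]; exact Pmul _ _ ih hg
  have hPπ : P π := ⟨hπb, hβ⟩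
  have P1 : P 1 := by
    have h := Ppow π hPπ (orderOf π - 1)
    rwa [Nat.sub_add_cancel (orderOf_pos π), pow_orderOf_eq_one] at h
  have Pinv : ∀ g, P g → P g⁻¹ := by
    intro g hg
    have h1 : g⁻¹ ∈ Submonoid.powers g := by
      rw [mem_powers_iff_mem_zpowers]
      exact Subgroup.inv_mem _ (Subgroup.mem_zpowers g)
    obtain ⟨t, ht⟩ := h1
    have ht' : g ^ t = g⁻¹ := ht
    rw [← ht']
    rcases t with _ | t
    · simpa using P1
    · exact Ppow g hg t
  let H : Subgroup (Perm (Fin n)) :=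
    { carrier := {g | P g}, mul_mem' := fun {x y} hx hy => Pmul x y hx hy, one_mem' := P1, inv_mem' := fun {x} hx => Pinv x hx }
  have hswap := hπ H (by
    intro i hi i' hi'
    obtain ⟨m, h1, h2⟩ := htr i hi i' hi' b hb b hb
    have hfix : ∀ j ∉ A, (α ^ m) j = j := by
      intro j hj
      obtain ⟨t, h3, h4⟩ := htr i hi i hi b hb j hj
      rw [← h4, ← Perm.mul_apply, ← pow_add, add_comm, pow_add, Perm.mul_apply, h2]
    refine ⟨α ^ m, ⟨h2, hM _ (hpow m) _ P1.2⟩, h1, hfix⟩) hPπ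
  have hall : ∀ g : Perm (Fin n), g b = b → P g := by
    intro g hg
    have hgp : ∀ x, g x ≠ b ↔ x ≠ b := by
      intro x
      rw [not_iff_not]
      constructor
      · intro h; rw [← hg] at h; exact g.injective h
      · rintro rfl; exact hg
    have h1 : ∀ s : Perm {x // x ≠ b}, ofSubtype s ∈ H := by
      intro s
      induction s using swap_induction_on with
      | one => rw [map_one]; exact H.one_mem
      | swap_mul f x y hxy ih =>
        rw [map_mul, ofSubtype_swap_eq]
        exact H.mul_mem (hswap _ _ x.2 y.2) ih
    have h2 := h1 (g.subtypePerm hgp)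
    rw [ofSubtype_subtypePerm] at h2
    · exact h2
    · intro x hx h
      subst h; exact hx hg
  -- elements of rank n-1
  have hrk : ∀ γ : Fin n → Fin n, ∀ i ∈ A, ∀ j ∉ A, ∀ m ∉ A, γ i = γ j → (∀ x, γ x ≠ m) →
      (∀ x y, x ≠ j → y ≠ j → γ x = γ y → x = y) → γ ∈ M := by
    intro γ i hi j hj m hm hij hmiss hinj
    obtain ⟨s, hs1, hs2⟩ := htr a ha i hi b hb j hj
    obtain ⟨t, -, ht2⟩ := htr a ha a ha b hb m hm
    let γ' : Fin n → Fin n := fun x => if x = b then b else (α ^ t)⁻¹ (γ ((α ^ s) x))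
    have hne : ∀ x, (α ^ t)⁻¹ (γ x) ≠ b := by
      intro x h
      rw [Perm.inv_eq_iff_eq, ht2] at h
      exact hmiss x h
    have hinj' : Function.Injective γ' := by
      intro x y hxy
      simp only [γ'] at hxy
      split_ifs at hxy with h1 h2 h2
      · rw [h1, h2]
      · exact absurd hxy.symm (hne _)
      · exact absurd hxy (hne _)
      · have h6 := hinj _ _ ?_ ?_ ((α ^ t)⁻¹.injective hxy)
        · exact (α ^ s).injective h6
        · intro h; rw [← hs2] at h; exact h1 ((α ^ s).injective h)
        · intro h; rw [← hs2] at h; exact h2 ((α ^ s).injective h)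
    let g : Perm (Fin n) := Equiv.ofBijective γ' (Finite.injective_iff_bijective.mp hinj')
    have hgb : g b = b := by
      change γ' b = b
      simp [γ']
    have hgP := (hall g hgb).2
    have : γ = (α ^ t : Perm (Fin n)) ∘ ((g ∘ mrg a b) ∘ ((α ^ s)⁻¹ : Perm (Fin n))) := by
      funext x
      simp only [Function.comp]
      change γ x = (α ^ t) (γ' _)
      by_cases hx : (α ^ s)⁻¹ x = b
      · have hxj : x = j := by rw [← hs2, ← hx]; simp
        have e1 : mrg a b b = a := by simp [mrg]
        rw [hx, e1]
        simp only [γ', hab, if_false]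
        rw [hs1, hij, hxj]; simp
      · have e1 : mrg a b ((α ^ s)⁻¹ x) = (α ^ s)⁻¹ x := by simp only [mrg, hx, if_false]
        rw [e1]
        simp only [γ', hx, if_false]
        simp
    rw [this]
    exact hM _ (hpow t) _ (hM _ hgP _ (hinv s))
  -- induction on the rank
  have hind : ∀ d : ℕ, ∀ γ ∈ V A, n ≤ (Finset.univ.image γ).card + d → γ ∈ M := by
    intro d
    induction d with
    | zero =>
      intro γ hγ hd
      rw [mem_V] at hγ
      obtain ⟨-, m, -, hm⟩ := hγ
      exfalso
      have h1 : (Finset.univ.image γ).card < (Finset.univ : Finset (Fin n)).card := by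
        apply Finset.card_lt_card
        rw [Finset.ssubset_univ_iff]
        intro h
        have : m ∈ Finset.univ.image γ := by rw [h]; simp
        obtain ⟨x, -, hx⟩ := Finset.mem_image.mp this
        exact hm x hx
      simp only [Finset.card_univ, Fintype.card_fin] at h1
      omega
    | succ d ih =>
      intro γ hγ hd
      have hγ' := hγ
      rw [mem_V] at hγ
      obtain ⟨⟨i, hi, j, hj, hij⟩, m, hmA, hm⟩ := hγ
      by_cases hinj : ∀ x y, x ≠ j → y ≠ j → γ x = γ y → x = y
      · exact hrk γ i hi j hj m hmA hij hm hinj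
      push Not at hinj
      obtain ⟨u, v, huj, hvj, huv, hne⟩ := hinj
      have hij' : i ≠ j := fun h => hj (h ▸ hi)
      -- image is image of the complement of j and v
      have himg1 : Finset.univ.image γ = (Finset.univ.erase j).image γ := by
        ext y
        simp only [Finset.mem_image, Finset.mem_univ, true_and, Finset.mem_erase, and_true]
        constructor
        · rintro ⟨x, rfl⟩
          by_cases hx : x = j
          · exact ⟨i, hij', by rw [hx, hij]⟩
          · exact ⟨x, hx, rfl⟩
        · rintro ⟨x, -, rfl⟩; exact ⟨x, rfl⟩
      have himg2 : (Finset.univ.erase j).image γ = ((Finset.univ.erase j).erase v).image γ := by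
        ext y
        simp only [Finset.mem_image, Finset.mem_univ, Finset.mem_erase, and_true]
        constructor
        · rintro ⟨x, hx, rfl⟩
          by_cases hxv : x = v
          · exact ⟨u, ⟨hne, huj⟩, by rw [hxv, huv]⟩
          · exact ⟨x, ⟨hxv, hx⟩, rfl⟩
        · rintro ⟨x, ⟨-, hx⟩, rfl⟩; exact ⟨x, hx, rfl⟩
      have hcard : (Finset.univ.image γ).card ≤ n - 2 := by
        rw [himg1, himg2]
        refine Finset.card_image_le.trans ?_
        rw [Finset.card_erase_of_mem (by simp [hvj]), Finset.card_erase_of_mem (by simp), Finset.card_univ, Fintype.card_fin]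
        omega
      obtain ⟨z, hz, hzm⟩ := Finset.exists_mem_ne (s := (Finset.univ.image γ)ᶜ) (by
        rw [Finset.card_compl, Fintype.card_fin]; omega) m
      have hz' : ∀ x, γ x ≠ z := by
        intro x hx
        simp only [Finset.mem_compl, Finset.mem_image, Finset.mem_univ, true_and, not_exists] at hz
        exact hz x hx
      obtain ⟨b', hb', hbb⟩ := Finset.exists_mem_ne (by omega : 1 < Aᶜ.card) b
      rw [Finset.mem_compl] at hb'
      obtain ⟨τ, hτu, hτv, hτj⟩ := exists_perm3 u v j a b b' hne huj hvj hab (fun h => hb' (h ▸ ha)) hbb.symm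
      let ε : Fin n → Fin n := τ ∘ mrg i j
      let δ : Fin n → Fin n := fun y => if y = b' then z else γ (τ⁻¹ y)
      have hmrg : ∀ x, mrg i j x ≠ j := by
        intro x; unfold mrg; split_ifs with h
        · exact hij'
        · exact h
      have hτi : ∀ y, τ⁻¹ (τ y) = y := fun y => by simp
      have hδε : γ = δ ∘ ε := by
        funext x
        have h1 : τ (mrg i j x) ≠ b' := by
          rw [← hτj]; exact fun h => hmrg x (τ.injective h)
        simp only [δ, ε, Function.comp, h1, if_false, hτi]
        unfold mrg
        split_ifs with h
        · rw [h, hij]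
        · rfl
      have hε : ε ∈ M := by
        apply hrk ε i hi j hj b' hb'
        · simp [ε, mrg]
        · intro x h
          rw [← hτj] at h
          exact hmrg x (τ.injective h)
        · intro x y hx hy hxy
          have := τ.injective hxy
          simpa [mrg, hx, hy] using this
      have hδ : δ ∈ M := by
        apply ih
        · rw [mem_V]
          refine ⟨⟨a, ha, b, hb, ?_⟩, m, hmA, ?_⟩
          · have h1 : a ≠ b' := fun h => hb' (h ▸ ha)
            simp only [δ, h1, hbb.symm, if_false]
            rw [← hτu, ← hτv]; simpa using huv
          · intro x
            simp only [δ]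
            split_ifs
            · exact hzm
            · exact hm _
        · have hsub : insert z (Finset.univ.image γ) ⊆ Finset.univ.image δ := by
            intro y hy
            rw [Finset.mem_insert] at hy
            rcases hy with rfl | hy
            · exact Finset.mem_image.mpr ⟨b', Finset.mem_univ _, by simp [δ]⟩
            · obtain ⟨x, -, rfl⟩ := Finset.mem_image.mp hy
              exact Finset.mem_image.mpr ⟨ε x, Finset.mem_univ _, (congrFun hδε x).symm⟩
          have h2 := Finset.card_le_card hsub
          rw [Finset.card_insert_of_notMem (by simpa using hz')] at h2
          omega
      rw [hδε]
      exact hM _ hδ _ hε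
  intro γ hγ
  exact hind n γ hγ (by omega)

end Cor

namespace Cor

open Finset in
lemma greedy (c : ℕ) : ∀ (m : ℕ) (nb : Fin m → Finset (Fin m)) (_ : ∀ x, ∀ y ∈ nb x, y < x),
    ∏ x, (c - (nb x).card) ≤
      (univ.filter fun γ : Fin m → Fin c => ∀ x, ∀ y ∈ nb x, γ x ≠ γ y).card := by
  classical
  intro m
  induction m with
  | zero =>
    intro nb _
    simp
  | succ m ih =>
    intro nb h
    let nb' : Fin m → Finset (Fin m) := fun x => univ.filter fun y => y.castSucc ∈ nb x.castSucc
    have h' : ∀ x, ∀ y ∈ nb' x, y < x := by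
      intro x y hy
      simp only [nb', mem_filter, mem_univ, true_and] at hy
      exact h _ _ hy
    have hcard : ∀ x, (nb' x).card ≤ (nb x.castSucc).card := by
      intro x
      apply card_le_card_of_injOn (fun y => y.castSucc)
      · intro y hy
        simp only [nb', coe_filter, mem_univ, true_and, Set.mem_ofPred_eq] at hy
        exact hy
      · intro a _ b _ hab
        exact Fin.castSucc_injective m hab
    rw [Fin.prod_univ_castSucc]
    let S' := univ.filter fun γ : Fin m → Fin c => ∀ x, ∀ y ∈ nb' x, γ x ≠ γ y
    let nl : Finset (Fin m) := univ.filter fun y => y.castSucc ∈ nb (Fin.last m)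
    have hnl : nl.card ≤ (nb (Fin.last m)).card := by
      apply card_le_card_of_injOn (fun y => y.castSucc)
      · intro y hy
        simp only [nl, coe_filter, mem_univ, true_and, Set.mem_ofPred_eq] at hy
        exact hy
      · intro a _ b _ hab
        exact Fin.castSucc_injective m hab
    calc (∏ x : Fin m, (c - (nb x.castSucc).card)) * (c - (nb (Fin.last m)).card)
        ≤ S'.card * (c - (nb (Fin.last m)).card) := by
          apply Nat.mul_le_mul_right
          refine le_trans ?_ (ih nb' h')
          apply prod_le_prod
          · intros; exact Nat.zero_le _
          · intro x _; have := hcard x; omega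
      _ ≤ ∑ γ ∈ S', ((nl.image γ)ᶜ).card := by
          rw [← smul_eq_mul]
          apply card_nsmul_le_sum
          intro γ _
          rw [card_compl, Fintype.card_fin]
          have : (nl.image γ).card ≤ nl.card := card_image_le
          omega
      _ = (S'.sigma fun γ => (nl.image γ)ᶜ).card := (card_sigma _ _).symm
      _ ≤ _ := by
          apply card_le_card_of_injOn (fun p => (Fin.snoc p.1 p.2 : Fin (m+1) → Fin c))
          · rintro ⟨γ, a⟩ hp
            simp only [coe_sigma, Set.mem_sigma_iff, mem_coe, mem_compl, mem_image, S', nl,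
              mem_filter, mem_univ, true_and, not_exists, not_and] at hp
            simp only [coe_filter, mem_univ, true_and, Set.mem_ofPred_eq]
            intro x y hy
            have hyx := h x y hy
            induction x using Fin.lastCases with
            | last =>
              induction y using Fin.lastCases with
              | last => exact absurd hyx (lt_irrefl _)
              | cast y =>
                rw [Fin.snoc_last, Fin.snoc_castSucc]
                exact fun e => hp.2 y hy e.symm
            | cast x =>
              induction y using Fin.lastCases with
              | last => exact absurd hyx (not_lt.mpr (Fin.le_last _))
              | cast y =>
                rw [Fin.snoc_castSucc, Fin.snoc_castSucc]
                exact hp.1 x y (by simp [nb', hy])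
          · rintro ⟨γ, a⟩ _ ⟨γ', a'⟩ _ e
            simp only at e
            have := Fin.snoc_inj.mp e
            obtain ⟨rfl, rfl⟩ := this
            rfl

lemma pw (n d : ℕ) (hn : 2 ≤ n) (hd : d ≤ 2) : n ^ 2 * (n - 2) ^ d ≤ (n - d) ^ 2 * n ^ d := by
  obtain ⟨k, rfl⟩ := Nat.exists_eq_add_of_le' hn
  interval_cases d
  · simp
  · simp only [Nat.add_sub_cancel, show k + 2 - 1 = k + 1 from rfl]; nlinarith
  · simp only [Nat.add_sub_cancel]; rw [mul_comm]

open Finset in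
lemma card_Pσ {n : ℕ} (hn : 2 ≤ n) (σ : Equiv.Perm (Fin n)) :
    (n * (n - 2)) ^ n ≤
      (univ.filter fun γ : Fin n → Fin n => ∀ x, σ x ≠ x → γ x ≠ γ (σ x)).card ^ 2 := by
  classical
  let nb : Fin n → Finset (Fin n) := fun x => ({σ x, σ⁻¹ x} : Finset (Fin n)).filter (· < x)
  have hnb : ∀ x, ∀ y ∈ nb x, y < x := fun x y hy => (mem_filter.mp hy).2
  have hg := greedy n n nb hnb
  have hsub : (univ.filter fun γ : Fin n → Fin n => ∀ x, ∀ y ∈ nb x, γ x ≠ γ y) ⊆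
      univ.filter fun γ : Fin n → Fin n => ∀ x, σ x ≠ x → γ x ≠ γ (σ x) := by
    intro γ hγ
    simp only [mem_filter, mem_univ, true_and] at hγ ⊢
    intro x hx
    rcases lt_or_gt_of_ne hx with h | h
    · exact hγ x (σ x) (by simp [nb, h])
    · exact (hγ (σ x) x (by simp [nb, h])).symm
  have hg2 := hg.trans (card_le_card hsub)
  set P := (univ.filter fun γ : Fin n → Fin n => ∀ x, σ x ≠ x → γ x ≠ γ (σ x)).card
  let D := ∑ x, (nb x).card
  have hd2 : ∀ x, (nb x).card ≤ 2 := fun x => (card_filter_le _ _).trans card_le_two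
  have hD : D ≤ n := by
    have h1 : ∀ x, (nb x).card ≤ (if σ x < x then 1 else 0) + (if σ⁻¹ x < x then 1 else 0) := by
      intro x
      simp only [nb, filter_insert, filter_singleton]
      split_ifs
      · exact card_le_two
      · simp
      · simp
      · simp
    calc D ≤ ∑ x, ((if σ x < x then 1 else 0) + (if σ⁻¹ x < x then 1 else 0)) :=
          sum_le_sum fun x _ => h1 x
      _ = ∑ x, (if σ x < x then 1 else 0) + ∑ x, (if σ⁻¹ x < x then 1 else 0) := sum_add_distrib
      _ = ∑ x, (if σ x < x then 1 else 0) + ∑ x, (if x < σ x then 1 else 0) := by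
          congr 1
          rw [← Equiv.sum_comp σ]
          simp
      _ = ∑ x, ((if σ x < x then 1 else 0) + (if x < σ x then 1 else 0)) := sum_add_distrib.symm
      _ ≤ ∑ x : Fin n, 1 := by
          apply sum_le_sum
          intro x _
          split_ifs with h1 h2
          · exact absurd h1 (not_lt.mpr h2.le)
          · simp
          · simp
          · simp
      _ = n := by simp
  have hprod : n ^ (2 * n) * (n - 2) ^ D ≤ P ^ 2 * n ^ D := by
    calc n ^ (2 * n) * (n - 2) ^ D = ∏ x, (n ^ 2 * (n - 2) ^ (nb x).card) := by
          rw [prod_mul_distrib, prod_const, card_univ, Fintype.card_fin, ← pow_mul, prod_pow_eq_pow_sum]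
      _ ≤ ∏ x, ((n - (nb x).card) ^ 2 * n ^ (nb x).card) :=
          prod_le_prod (fun _ _ => Nat.zero_le _) fun x _ => pw n _ hn (hd2 x)
      _ = (∏ x, (n - (nb x).card)) ^ 2 * n ^ D := by
          rw [prod_mul_distrib, prod_pow_eq_pow_sum, prod_pow]
      _ ≤ _ := Nat.mul_le_mul_right _ (Nat.pow_le_pow_left hg2 2)
  have hpos : 0 < n ^ n := by positivity
  apply Nat.le_of_mul_le_mul_right _ hpos
  calc (n * (n - 2)) ^ n * n ^ n = n ^ (2 * n) * (n - 2) ^ n := by rw [mul_pow]; ring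
    _ = n ^ (2 * n) * (n - 2) ^ D * (n - 2) ^ (n - D) := by
        rw [mul_assoc, ← pow_add, Nat.add_sub_cancel' hD]
    _ ≤ P ^ 2 * n ^ D * n ^ (n - D) :=
        Nat.mul_le_mul hprod (Nat.pow_le_pow_left (Nat.sub_le _ _) _)
    _ = P ^ 2 * n ^ n := by rw [mul_assoc, ← pow_add, Nat.add_sub_cancel' hD]

/-- upper bound for the number of maps from an m-set to an n-set covering a given s-set -/
def Ncov (n : ℕ) : ℕ → ℕ → ℕ
  | 0, 0 => 1
  | 0, _ + 1 => 0
  | m + 1, 0 => n * Ncov n m 0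
  | m + 1, s + 1 => (s + 1) * Ncov n m s + (n - (s + 1)) * Ncov n m (s + 1)

open Finset in
lemma cover_le (n : ℕ) : ∀ (m : ℕ) (S : Finset (Fin n)),
    (univ.filter fun γ : Fin m → Fin n => ∀ y ∈ S, ∃ x, γ x = y).card ≤ Ncov n m S.card := by
  classical
  intro m
  induction m with
  | zero =>
    intro S
    rcases S.eq_empty_or_nonempty with rfl | ⟨y, hy⟩
    · simp [Ncov]
    · rw [filter_eq_empty_iff.mpr]
      · simp
      · intro γ _ h
        obtain ⟨x, _⟩ := h y hy
        exact x.elim0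
  | succ m ih =>
    intro S
    let T : Finset (Fin n) → Finset (Fin m → Fin n) := fun S =>
      univ.filter fun γ : Fin m → Fin n => ∀ y ∈ S, ∃ x, γ x = y
    have h1 : (univ.filter fun γ : Fin (m+1) → Fin n => ∀ y ∈ S, ∃ x, γ x = y).card ≤
        ((univ : Finset (Fin n)).sigma fun a => T (S.erase a)).card := by
      apply card_le_card_of_injOn (fun γ => (⟨γ 0, Fin.tail γ⟩ : (_ : Fin n) × (Fin m → Fin n)))
      · intro γ hγ
        simp only [coe_filter, mem_univ, true_and, Set.mem_ofPred_eq] at hγ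
        simp only [coe_sigma, Set.mem_sigma_iff, mem_coe, mem_univ, true_and, T, mem_filter]
        intro y hy
        rw [mem_erase] at hy
        obtain ⟨x, hx⟩ := hγ y hy.2
        induction x using Fin.cases with
        | zero => exact absurd hx.symm hy.1
        | succ x => exact ⟨x, hx⟩
      · intro γ _ γ' _ e
        simp only [Sigma.mk.injEq, heq_eq_eq] at e
        rw [← Fin.cons_self_tail γ, ← Fin.cons_self_tail γ', e.1, e.2]
    refine h1.trans ?_
    rw [card_sigma]
    have h2 : ∑ a : Fin n, (T (S.erase a)).card ≤ ∑ a : Fin n, Ncov n m (S.erase a).card :=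
      sum_le_sum fun a _ => ih (S.erase a)
    refine h2.trans ?_
    rw [← sum_add_sum_compl S]
    have h3 : ∑ a ∈ S, Ncov n m (S.erase a).card = S.card * Ncov n m (S.card - 1) := by
      rw [sum_congr rfl (fun a ha => by rw [card_erase_of_mem ha]), sum_const, smul_eq_mul]
    have h4 : ∑ a ∈ Sᶜ, Ncov n m (S.erase a).card = (n - S.card) * Ncov n m S.card := by
      rw [sum_congr rfl (fun a ha => by rw [erase_eq_of_notMem (mem_compl.mp ha)]), sum_const,
        smul_eq_mul, card_compl, Fintype.card_fin]
    rw [h3, h4]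
    rcases hS : S.card with _ | s
    · simp [Ncov]
    · simp [Ncov]

lemma Ncov_le (n : ℕ) : ∀ m s, Ncov n m s * n ^ s ≤ s.factorial * m.choose s * n ^ m := by
  intro m
  induction m with
  | zero => intro s; cases s <;> simp [Ncov]
  | succ m ih =>
    intro s
    cases s with
    | zero =>
      have := ih 0
      simp only [Ncov, pow_zero, mul_one, Nat.factorial_zero, Nat.choose_zero_right, one_mul] at this ⊢
      rw [pow_succ, mul_comm]; exact Nat.mul_le_mul_right _ this
    | succ s =>
      have h1 := ih s
      have h2 := ih (s + 1)
      simp only [Ncov]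
      rw [Nat.choose_succ_succ]
      calc _ = (s + 1) * n * (Ncov n m s * n ^ s) + (n - (s+1)) * (Ncov n m (s + 1) * n ^ (s + 1)) := by ring
        _ ≤ (s + 1) * n * (s.factorial * m.choose s * n ^ m) + n * ((s + 1).factorial * m.choose (s+1) * n ^ m) := by
          gcongr; omega
        _ = _ := by rw [Nat.factorial_succ]; ring

/-- bound for the complement of V for a two-element set -/
def comp (n : ℕ) : ℕ :=
  n * (n - 1) ^ (n - 2) + n * (n - 1) * (n - 2) ^ (n - 2) + Ncov n n (n - 2)

open Finset in
lemma card_disj {n : ℕ} (a b : Fin n) (hab : a ≠ b) :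
    (univ.filter fun γ : Fin n → Fin n => ∀ y, y ≠ a → y ≠ b → γ a ≠ γ y ∧ γ b ≠ γ y).card ≤
      n * (n - 1) ^ (n - 2) + n * (n - 1) * (n - 2) ^ (n - 2) := by
  classical
  let Q : Fin n × Fin n → Finset (Fin n → Fin n) := fun p =>
    Fintype.piFinset fun x => if x = a then {p.1} else if x = b then {p.2} else ({p.1, p.2} : Finset _)ᶜ
  have hQ : ∀ p, (Q p).card = (n - ({p.1, p.2} : Finset (Fin n)).card) ^ (n - 2) := by
    intro p
    simp only [Q, Fintype.card_piFinset]
    rw [← mul_prod_erase univ _ (mem_univ a), ← mul_prod_erase (univ.erase a) _ (mem_erase.mpr ⟨hab.symm, mem_univ b⟩)]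
    simp only [if_true, hab.symm, if_false, card_singleton, one_mul]
    rw [prod_congr rfl (g := fun _ => (n - ({p.1, p.2} : Finset (Fin n)).card)), prod_const,
      card_erase_of_mem (mem_erase.mpr ⟨hab.symm, mem_univ b⟩), card_erase_of_mem (mem_univ a), card_univ,
      Fintype.card_fin]
    · rfl
    · intro x hx
      simp only [mem_erase] at hx
      rw [if_neg hx.2.1, if_neg hx.1, card_compl, Fintype.card_fin]
  have hsub : (univ.filter fun γ : Fin n → Fin n => ∀ y, y ≠ a → y ≠ b → γ a ≠ γ y ∧ γ b ≠ γ y) ⊆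
      univ.biUnion Q := by
    intro γ hγ
    simp only [mem_filter, mem_univ, true_and] at hγ
    simp only [mem_biUnion, mem_univ, true_and]
    refine ⟨(γ a, γ b), ?_⟩
    simp only [Q, Fintype.mem_piFinset]
    intro x
    split_ifs with h1 h2
    · simp [h1]
    · simp [h2]
    · have := hγ x h1 h2
      simp [this.1.symm, this.2.symm]
  refine (card_le_card hsub).trans (card_biUnion_le.trans ?_)
  rw [← univ_product_univ, sum_product]
  have : ∀ u : Fin n, ∑ v : Fin n, (Q (u, v)).card = (n - 1) ^ (n - 2) + (n - 1) * (n - 2) ^ (n - 2) := by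
    intro u
    rw [← add_sum_erase univ _ (mem_univ u)]
    congr 1
    · rw [hQ]; simp
    · rw [sum_congr rfl (g := fun _ => (n - 2) ^ (n - 2)), sum_const, card_erase_of_mem (mem_univ u)]
      · simp
      · intro v hv
        rw [hQ, card_pair (ne_of_mem_erase hv).symm]
  simp only [this, sum_const, card_univ, Fintype.card_fin, smul_eq_mul]
  apply le_of_eq; ring

open Finset in
lemma card_V_two {n : ℕ} (hn : 7 ≤ n) : n ^ n ≤ (V (Ak n 2)).card + comp n := by
  classical
  let a : Fin n := ⟨0, by omega⟩
  let b : Fin n := ⟨1, by omega⟩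
  have hab : a ≠ b := by simp [a, b]
  have hA : ∀ x, x ∈ Ak n 2 ↔ (x = a ∨ x = b) := by
    intro x; rw [mem_Ak, Fin.ext_iff, Fin.ext_iff]; simp only [a, b]; omega
  let S1 := univ.filter fun γ : Fin n → Fin n => ∀ y, y ≠ a → y ≠ b → γ a ≠ γ y ∧ γ b ≠ γ y
  let S2 := univ.filter fun γ : Fin n → Fin n => ∀ y ∈ (Ak n 2)ᶜ, ∃ x, γ x = y
  have hsub : (univ : Finset (Fin n → Fin n)) ⊆ V (Ak n 2) ∪ (S1 ∪ S2) := by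
    intro γ _
    by_contra hc
    simp only [mem_union, not_or, mem_V, S1, S2, mem_filter, mem_univ, true_and] at hc
    obtain ⟨h1, h2, h3⟩ := hc
    apply h1
    push Not at h2 h3
    obtain ⟨y, hya, hyb, hy⟩ := h2
    obtain ⟨m, hm, hm2⟩ := h3
    refine ⟨?_, m, mem_compl.mp hm, hm2⟩
    have hyA : y ∉ Ak n 2 := by rw [hA]; simp [hya, hyb]
    by_cases h : γ a = γ y
    · exact ⟨a, (hA a).mpr (Or.inl rfl), y, hyA, h⟩
    · exact ⟨b, (hA b).mpr (Or.inr rfl), y, hyA, hy h⟩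
  have h1 := card_le_card hsub
  have h2 := card_union_le (V (Ak n 2)) (S1 ∪ S2)
  have h3 := card_union_le S1 S2
  have h4 : S1.card ≤ _ := card_disj a b hab
  have h5 : S2.card ≤ _ := cover_le n n (Ak n 2)ᶜ
  rw [card_compl, Fintype.card_fin, card_Ak (by omega)] at h5
  simp only [card_univ, Fintype.card_fun, Fintype.card_fin] at h1
  unfold comp
  omega

open Finset in
lemma card_eq_pair {n : ℕ} (i j : Fin n) (hij : i ≠ j) :
    (univ.filter fun γ : Fin n → Fin n => γ i = γ j).card ≤ n ^ (n - 1) := by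
  classical
  have : (univ.filter fun γ : Fin n → Fin n => γ i = γ j).card ≤ (univ : Finset ({x // x ≠ j} → Fin n)).card := by
    apply card_le_card_of_injOn (fun γ x => γ x.1)
    · intro _ _; simp
    · intro γ hγ γ' hγ' e
      simp only [coe_filter, mem_univ, true_and, Set.mem_ofPred_eq] at hγ hγ'
      funext x
      by_cases hx : x = j
      · subst hx
        rw [← hγ, ← hγ']; exact congrFun e ⟨i, hij⟩
      · exact congrFun e ⟨x, hx⟩
  refine this.trans (le_of_eq ?_)
  rw [card_univ, Fintype.card_fun, Fintype.card_fin]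
  congr 1
  rw [Fintype.card_subtype_compl, Fintype.card_fin]; simp

open Finset in
lemma card_miss {n : ℕ} (p : Fin n) :
    (univ.filter fun γ : Fin n → Fin n => ∀ x, γ x ≠ p).card ≤ (n - 1) ^ n := by
  classical
  have : (univ.filter fun γ : Fin n → Fin n => ∀ x, γ x ≠ p) = Fintype.piFinset fun _ => univ.erase p := by
    ext γ; simp [Fintype.mem_piFinset]
  rw [this, Fintype.card_piFinset]
  simp

open Finset in
lemma card_alone {n : ℕ} (i : Fin n) :
    n * (n - 1) ^ (n - 1) ≤ (univ.filter fun γ : Fin n → Fin n => ∀ y, y ≠ i → γ y ≠ γ i).card := by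
  classical
  have h : (univ.biUnion fun u : Fin n => Fintype.piFinset fun x => if x = i then {u} else univ.erase u) ⊆
      (univ.filter fun γ : Fin n → Fin n => ∀ y, y ≠ i → γ y ≠ γ i) := by
    intro γ hγ
    simp only [mem_biUnion, mem_univ, true_and, Fintype.mem_piFinset] at hγ
    obtain ⟨u, hu⟩ := hγ
    simp only [mem_filter, mem_univ, true_and]
    intro y hy
    have h1 := hu i
    have h2 := hu y
    simp only [if_true, mem_singleton] at h1
    rw [if_neg hy] at h2
    rw [h1]; exact ne_of_mem_erase h2
  refine le_trans (le_of_eq ?_) (card_le_card h)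
  rw [card_biUnion]
  · have : ∀ u : Fin n, (Fintype.piFinset fun x : Fin n => if x = i then ({u} : Finset (Fin n)) else univ.erase u).card = (n - 1) ^ (n - 1) := by
      intro u
      rw [Fintype.card_piFinset, ← mul_prod_erase univ _ (mem_univ i), if_pos rfl, card_singleton, one_mul,
        prod_congr rfl (g := fun _ => n - 1), prod_const, card_erase_of_mem (mem_univ i)]
      · simp
      · intro x hx; rw [if_neg (ne_of_mem_erase hx)]; simp
    simp [this]
  · intro u _ v _ huv
    rw [Function.onFun, disjoint_left]
    intro γ h1 h2
    have h1 := Fintype.mem_piFinset.mp h1 i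
    have h2 := Fintype.mem_piFinset.mp h2 i
    simp only [if_true, mem_singleton] at h1 h2
    exact huv (h1.symm.trans h2)

open Finset in
lemma card_inj (n : ℕ) : (univ.filter fun γ : Fin n → Fin n => Function.Injective γ).card ≤ n.factorial := by
  classical
  have : (univ.filter fun γ : Fin n → Fin n => Function.Injective γ) ⊆
      (univ : Finset (Equiv.Perm (Fin n))).image (fun σ : Equiv.Perm (Fin n) => (⇑σ : Fin n → Fin n)) := by
    intro γ hγ
    simp only [mem_filter, mem_univ, true_and] at hγ
    rw [mem_image]
    exact ⟨Equiv.ofBijective γ (Finite.injective_iff_bijective.mp hγ), mem_univ _, rfl⟩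
  refine (card_le_card this).trans (card_image_le.trans ?_)
  rw [card_univ, Fintype.card_perm, Fintype.card_fin]

open Finset in
lemma card_compl_filter {n : ℕ} (p : (Fin n → Fin n) → Prop) [DecidablePred p] (S : Finset (Fin n → Fin n)) (c : ℕ)
    (hc : c ≤ (univ.filter p).card) (hS : ∀ γ ∈ S, ¬ p γ) : S.card + c ≤ n ^ n := by
  classical
  have h : Disjoint S (univ.filter p) := by
    rw [disjoint_left]; intro γ h1 h2; exact hS γ h1 (mem_filter.mp h2).2
  have h2 := card_le_univ (S ∪ univ.filter p)
  rw [card_union_of_disjoint h, Fintype.card_fun, Fintype.card_fin] at h2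
  omega

end Cor

namespace Cor

lemma pow_exp (q : ℕ) (hq : 1 ≤ q) : 1000 * (q - 1) ^ q ≤ 368 * q ^ q := by
  have h := Real.one_sub_div_pow_le_exp_neg (n := q) (t := 1) (by exact_mod_cast hq)
  have h2 := h.trans Real.exp_neg_one_lt_d9.le
  have hq0 : (0:ℝ) < q := by exact_mod_cast hq
  have h3 : (1 - 1 / (q:ℝ)) = ((q - 1 : ℕ) : ℝ) / q := by
    rw [Nat.cast_sub hq]; field_simp; simp
  rw [h3, div_pow, div_le_iff₀ (by positivity)] at h2
  have h4 : (0:ℝ) < (q:ℝ) ^ q := by positivity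
  have : (1000 * (q - 1 : ℕ) ^ q : ℝ) ≤ 368 * (q:ℝ) ^ q := by nlinarith
  exact_mod_cast this

lemma fact_bound (n : ℕ) (hn : 11 ≤ n) : 50 * (n.factorial * n ^ 2) ≤ 3 * (n - 1) ^ n := by
  induction n, hn using Nat.le_induction with
  | base => decide
  | succ n hn ih =>
    simp only [Nat.add_sub_cancel]
    have h1 := pow_exp n (by omega)
    have h2 : 2 * (n - 1) ^ n ≤ n ^ n := by omega
    have hpos : 0 < n ^ 2 := by positivity
    apply Nat.le_of_mul_le_mul_left _ hpos
    have h3 : (n + 1) ^ 3 ≤ 2 * n ^ 3 := by nlinarith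
    calc n ^ 2 * (50 * ((n + 1).factorial * (n + 1) ^ 2))
        = (50 * (n.factorial * n ^ 2)) * (n + 1) ^ 3 := by rw [Nat.factorial_succ]; ring
      _ ≤ (3 * (n - 1) ^ n) * (2 * n ^ 3) := Nat.mul_le_mul ih h3
      _ = 3 * n ^ 3 * (2 * (n - 1) ^ n) := by ring
      _ ≤ 3 * n ^ 3 * n ^ n := Nat.mul_le_mul_left _ h2
      _ = _ := by ring

lemma Ncov_bound (n : ℕ) (hn : 2 ≤ n) : 2 * Ncov n n (n - 2) ≤ n.factorial * n ^ 2 := by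
  have h := Ncov_le n n (n - 2)
  have h2 := Nat.choose_mul_factorial_mul_factorial (Nat.sub_le n 2)
  rw [Nat.sub_sub_self hn, Nat.factorial_two] at h2
  have hpos : 0 < n ^ (n - 2) := by positivity
  apply Nat.le_of_mul_le_mul_right _ hpos
  calc 2 * Ncov n n (n - 2) * n ^ (n - 2) = 2 * (Ncov n n (n - 2) * n ^ (n - 2)) := by ring
    _ ≤ 2 * ((n - 2).factorial * n.choose (n - 2) * n ^ n) := by omega
    _ = (n.choose (n - 2) * (n - 2).factorial * 2) * n ^ n := by ring
    _ = n.factorial * (n ^ 2 * n ^ (n - 2)) := by rw [h2, ← pow_add]; congr 2; omega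
    _ = _ := by ring

/-- the total slack needed -/
def XX (n : ℕ) : ℕ := comp n + n.factorial + n * (n - 1) / 2

lemma XX_bound (n : ℕ) (hn : 11 ≤ n) : 100 * XX n ≤ 62 * (n - 1) ^ n := by
  have hf := fact_bound n hn
  have hN := Ncov_bound n (by omega)
  have h11 : 11 ^ 2 ≤ n ^ 2 := Nat.pow_le_pow_left hn 2
  have hfn : n.factorial * 121 ≤ n.factorial * n ^ 2 := Nat.mul_le_mul_left _ (by omega)
  have hfac : 50 * n ^ 2 ≤ n.factorial * n ^ 2 := by
    apply Nat.mul_le_mul_right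
    have : Nat.factorial 11 ≤ n.factorial := Nat.factorial_le hn
    have e : Nat.factorial 11 = 39916800 := by decide
    omega
  have hC : n * (n - 1) / 2 ≤ n ^ 2 := by
    refine (Nat.div_le_self _ _).trans ?_
    rw [sq]; exact Nat.mul_le_mul_left _ (by omega)
  obtain ⟨r, rfl⟩ := Nat.exists_eq_add_of_le' (show 2 ≤ n by omega)
  have hr : 9 ≤ r := by omega
  have hT1 : 100 * ((r + 2) * (r + 1) ^ r) ≤ 12 * (r + 1) ^ (r + 2) := by
    calc 100 * ((r + 2) * (r + 1) ^ r) = (100 * (r + 2)) * (r + 1) ^ r := by ring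
      _ ≤ (12 * (r + 1) ^ 2) * (r + 1) ^ r := Nat.mul_le_mul_right _ (by nlinarith)
      _ = _ := by ring
  have hT2 : 100 * ((r + 2) * (r + 1) * r ^ r) ≤ 45 * (r + 1) ^ (r + 2) := by
    have h := pow_exp (r + 1) (by omega)
    simp only [Nat.add_sub_cancel] at h
    have hpos : 0 < 10 * r := by omega
    apply Nat.le_of_mul_le_mul_left _ hpos
    calc 10 * r * (100 * ((r + 2) * (r + 1) * r ^ r)) = (1000 * r ^ (r + 1)) * ((r + 2) * (r + 1)) := by ring
      _ ≤ (368 * (r + 1) ^ (r + 1)) * ((r + 2) * (r + 1)) := Nat.mul_le_mul_right _ h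
      _ = (368 * (r + 2)) * (r + 1) ^ (r + 2) := by ring
      _ ≤ (450 * r) * (r + 1) ^ (r + 2) := Nat.mul_le_mul_right _ (by omega)
      _ = _ := by ring
  unfold XX comp
  simp only [show r + 2 - 1 = r + 1 from rfl, show r + 2 - 2 = r from rfl] at *
  omega

lemma XX7 : XX 7 = 242823 := by
  simp only [XX, comp]
  norm_num [Ncov, Nat.factorial]

lemma numA (n P : ℕ) (hn : n = 7 ∨ 11 ≤ n) (hP : (n * (n - 2)) ^ n ≤ P ^ 2) : XX n ≤ P := by
  rcases hn with rfl | hn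
  · rw [XX7]
    by_contra h
    have : P ^ 2 ≤ 242822 ^ 2 := Nat.pow_le_pow_left (by omega) 2
    norm_num at hP this
    omega
  · have h := XX_bound n hn
    by_contra hlt
    have h1 : 100 * P ≤ 62 * (n - 1) ^ n := by omega
    have h2 : (100 * P) ^ 2 ≤ (62 * (n - 1) ^ n) ^ 2 := Nat.pow_le_pow_left h1 2
    -- Bernoulli
    obtain ⟨q, rfl⟩ := Nat.exists_eq_add_of_le' (show 1 ≤ n by omega)
    have e : (q + 1) * (q + 1 - 2) = q ^ 2 - 1 := by
      obtain ⟨s, rfl⟩ := Nat.exists_eq_add_of_le' (show 1 ≤ q by omega)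
      simp only [show s + 1 + 1 - 2 = s by omega]
      rw [eq_comm, Nat.sub_eq_iff_eq_add (Nat.one_le_pow _ _ (by omega))]; ring
    rw [e] at hP
    simp only [Nat.add_sub_cancel] at *
    have hq2 : 1 ≤ q ^ 2 := Nat.one_le_pow _ _ (by omega)
    have hb : (q ^ 2) ^ (q + 1) ≤ (q ^ 2 - 1) ^ (q + 1) + (q + 1) * (q ^ 2) ^ q := by
      have hq0 : (0:ℝ) < (q:ℝ) ^ 2 := by
        have : 0 < q := by omega
        positivity
      have hb := one_add_mul_le_pow (a := -(1 / (q:ℝ) ^ 2)) (by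
        have h1 : 1 / (q:ℝ) ^ 2 ≤ 1 := by
          rw [div_le_one hq0]; exact_mod_cast hq2
        linarith) (q + 1)
      have h3 : (1 + -(1 / (q:ℝ) ^ 2)) = ((q ^ 2 - 1 : ℕ) : ℝ) / (q:ℝ) ^ 2 := by
        have hq1 : (q:ℝ) ≠ 0 := by intro h0; rw [h0] at hq0; simp at hq0
        rw [Nat.cast_sub hq2]; push_cast; field_simp; ring
      rw [h3, div_pow, le_div_iff₀ (by positivity)] at hb
      have h5 : (1 + ((q + 1 : ℕ) : ℝ) * -(1 / (q:ℝ) ^ 2)) * ((q:ℝ) ^ 2) ^ (q + 1) = ((q:ℝ) ^ 2) ^ (q + 1) - ((q:ℝ) + 1) * ((q:ℝ) ^ 2) ^ q := by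
        have hq1 : (q:ℝ) ≠ 0 := by intro h0; rw [h0] at hq0; simp at hq0
        rw [pow_succ]
        generalize ((q:ℝ) ^ 2) ^ q = X
        push_cast; field_simp; ring
      rw [h5] at hb
      have : ((q:ℝ) ^ 2) ^ (q + 1) ≤ ((q ^ 2 - 1 : ℕ) : ℝ) ^ (q + 1) + ((q:ℝ) + 1) * ((q:ℝ) ^ 2) ^ q := by linarith
      exact_mod_cast this
    have h6 : 100 * ((q + 1) * (q ^ 2) ^ q) ≤ 12 * (q ^ 2) ^ (q + 1) := by
      calc 100 * ((q + 1) * (q ^ 2) ^ q) = (100 * (q + 1)) * (q ^ 2) ^ q := by ring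
        _ ≤ (12 * q ^ 2) * (q ^ 2) ^ q := Nat.mul_le_mul_right _ (by nlinarith)
        _ = _ := by ring
    have h7 : (100 * P) ^ 2 = 10000 * P ^ 2 := by ring
    have h8 : (62 * q ^ (q + 1)) ^ 2 = 3844 * (q ^ 2) ^ (q + 1) := by rw [mul_pow, ← pow_mul, ← pow_mul, mul_comm (q+1) 2]; norm_num
    have h9 : 0 < (q ^ 2) ^ (q + 1) := by positivity
    omega

lemma numB1 (n : ℕ) (hn : n = 7 ∨ 11 ≤ n) : XX n ≤ (n - 1) ^ n := by
  rcases hn with rfl | hn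
  · rw [XX7]; norm_num
  · have := XX_bound n hn; omega

lemma numB1' (n : ℕ) (hn : n = 7 ∨ 11 ≤ n) : XX n ≤ n * (n - 1) ^ (n - 1) := by
  refine (numB1 n hn).trans ?_
  obtain ⟨q, rfl⟩ := Nat.exists_eq_add_of_le' (show 1 ≤ n by omega)
  simp only [Nat.add_sub_cancel]
  rw [pow_succ, mul_comm]; exact Nat.mul_le_mul_right _ (by omega)

lemma numB2 (n : ℕ) (hn : n = 7 ∨ 11 ≤ n) : 2 * (n - 1) ^ n + XX n ≤ n ^ n := by
  rcases hn with rfl | hn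
  · rw [XX7]; norm_num
  · have := XX_bound n hn
    have := pow_exp n (by omega)
    omega

lemma numI (n : ℕ) (hn : n = 7 ∨ 11 ≤ n) : 1 + 2 * n ^ (n - 1) + XX n ≤ n ^ n := by
  rcases hn with rfl | hn
  · rw [XX7]; norm_num
  · have h1 := XX_bound n hn
    have h2 := pow_exp n (by omega)
    have h3 : 11 * n ^ (n - 1) ≤ n ^ n := by
      obtain ⟨q, rfl⟩ := Nat.exists_eq_add_of_le' (show 1 ≤ n by omega)
      simp only [Nat.add_sub_cancel]
      rw [pow_succ, mul_comm]; exact Nat.mul_le_mul_left _ hn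
    have h4 : 0 < n ^ (n - 1) := by positivity
    omega

lemma numII (n : ℕ) (hn : n = 7 ∨ 11 ≤ n) : XX n ≤ n ^ n :=
  (numB1 n hn).trans (Nat.pow_le_pow_left (by omega) _)

lemma numB3 (n : ℕ) (hn : 7 ≤ n) : 2 ^ n + n * (n - 1) / 2 ≤ (n - 1).factorial := by
  have : 2 ^ n + n * (n - 1) ≤ (n - 1).factorial := by
    induction n, hn using Nat.le_induction with
    | base => decide
    | succ n hn ih =>
      obtain ⟨q, rfl⟩ := Nat.exists_eq_add_of_le' (show 1 ≤ n by omega)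
      simp only [Nat.add_sub_cancel] at *
      rw [Nat.factorial_succ]
      have : (q + 1) * (2 ^ (q+1) + (q+1) * q) ≤ (q + 1) * q.factorial := Nat.mul_le_mul_left _ ih
      have h2 : 2 * 2 ^ (q+1) ≤ (q + 1) * 2 ^ (q + 1) := Nat.mul_le_mul_right _ (by omega)
      have h3 : 2 * ((q + 1) * q) ≤ (q+1) * ((q+1) * q) := Nat.mul_le_mul_right _ (by omega)
      have h4 : (q + 1 + 1) * (q + 1) ≤ 2 * ((q + 1) * q) := by nlinarith
      rw [pow_succ]
      rw [mul_add] at this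
      omega
  omega

lemma seven_or (n : ℕ) (hp : n.Prime) (hn : 7 ≤ n) : n = 7 ∨ 11 ≤ n := by
  by_contra h
  have : n = 8 ∨ n = 9 ∨ n = 10 := by omega
  rcases this with rfl | rfl | rfl <;> revert hp <;> decide

end Cor

namespace Cor

open Equiv Equiv.Perm

lemma tr_cons {n : ℕ} (φ : Fin 2 → Fin n → Fin n) (c : Fin 2) (w : List (Fin 2)) :
    tr φ (c :: w) = tr φ w ∘ φ c := rfl

lemma tr_nil {n : ℕ} (φ : Fin 2 → Fin n → Fin n) : tr φ [] = id := rfl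

lemma tr_snoc {n : ℕ} (φ : Fin 2 → Fin n → Fin n) (c : Fin 2) (w : List (Fin 2)) :
    tr φ (w ++ [c]) = φ c ∘ tr φ w := by
  rw [tr_append]; rfl

lemma pow_mem_pows {n : ℕ} (α : Perm (Fin n)) (m : ℕ) : (⇑(α ^ m) : Fin n → Fin n) ∈ pows (⇑α) := by
  rw [mem_pows]
  refine ⟨m + orderOf α, ?_, ?_⟩
  · have := orderOf_pos α; omega
  · rw [← Equiv.Perm.coe_pow, pow_add, pow_orderOf_eq_one, mul_one]

lemma mem_pows_perm {n : ℕ} (α : Perm (Fin n)) (γ : Fin n → Fin n) (h : γ ∈ pows (⇑α)) :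
    ∃ m : ℕ, γ = ⇑(α ^ m) := by
  rw [mem_pows] at h
  obtain ⟨m, _, h⟩ := h
  exact ⟨m, by rw [h, Equiv.Perm.coe_pow]⟩

lemma tr_collapse {n : ℕ} (φ : Fin 2 → Fin n → Fin n) (a b : Fin 2) (hab : ∀ c, c = a ∨ c = b)
    (α : Perm (Fin n)) (hα : φ a = α) (i j : Fin n) (hβ : φ b i = φ b j) (w : List (Fin 2)) :
    (∃ m : ℕ, tr φ w = ⇑(α ^ m)) ∨ ∃ s : ℤ, tr φ w ((α ^ s) i) = tr φ w ((α ^ s) j) := by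
  induction w with
  | nil => left; exact ⟨0, by rw [tr_nil, pow_zero]; rfl⟩
  | cons c w ih =>
    rw [tr_cons]
    rcases hab c with rfl | rfl
    · rw [hα]
      rcases ih with ⟨m, hm⟩ | ⟨s, hs⟩
      · left; exact ⟨m + 1, by rw [hm, pow_succ]; rfl⟩
      · right
        refine ⟨s - 1, ?_⟩
        have h : ∀ x, α ((α ^ (s - 1)) x) = (α ^ s) x := by
          intro x
          rw [← Perm.mul_apply, ← zpow_one_add]; congr 2; ring
        simp only [Function.comp, h, hs]
    · right
      exact ⟨0, by simp [hβ]⟩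

lemma tr_miss {n : ℕ} (φ : Fin 2 → Fin n → Fin n) (a b : Fin 2) (hab : ∀ c, c = a ∨ c = b)
    (α : Perm (Fin n)) (hα : φ a = α) (p : Fin n) (hβ : ∀ x, φ b x ≠ p) (w : List (Fin 2)) :
    (∃ m : ℕ, tr φ w = ⇑(α ^ m)) ∨ ∃ s : ℤ, ∀ x, tr φ w x ≠ (α ^ s) p := by
  induction w using List.reverseRecOn with
  | nil => left; exact ⟨0, by rw [tr_nil, pow_zero]; rfl⟩
  | append_singleton w c ih =>
    rw [tr_snoc]
    rcases hab c with rfl | rfl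
    · rw [hα]
      rcases ih with ⟨m, hm⟩ | ⟨s, hs⟩
      · left; exact ⟨m + 1, by rw [hm, pow_succ']; rfl⟩
      · right
        refine ⟨1 + s, fun x h => hs x ?_⟩
        rw [zpow_one_add, Perm.mul_apply] at h
        exact α.injective h
    · right
      exact ⟨0, fun x => by simpa using hβ _⟩

open Classical in
/-- non-permutations reachable -/
noncomputable def NP {n : ℕ} (α : Perm (Fin n)) (i j p : Fin n) : Finset (Fin n → Fin n) :=
  Finset.univ.filter fun γ => (∃ s : ℤ, γ ((α ^ s) i) = γ ((α ^ s) j)) ∧ ∃ s : ℤ, ∀ x, γ x ≠ (α ^ s) p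

lemma mem_NP {n : ℕ} (α : Perm (Fin n)) (i j p : Fin n) (γ : Fin n → Fin n) : γ ∈ NP α i j p ↔
    (∃ s : ℤ, γ ((α ^ s) i) = γ ((α ^ s) j)) ∧ ∃ s : ℤ, ∀ x, γ x ≠ (α ^ s) p := by
  simp [NP]

lemma tr_mem {n : ℕ} (φ : Fin 2 → Fin n → Fin n) (a b : Fin 2) (hab : ∀ c, c = a ∨ c = b)
    (α : Perm (Fin n)) (hα : φ a = α) (i j p : Fin n) (hβ : φ b i = φ b j) (hβ' : ∀ x, φ b x ≠ p)
    (w : List (Fin 2)) : tr φ w ∈ NP α i j p ∪ pows (⇑α) := by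
  classical
  rw [Finset.mem_union]
  rcases tr_collapse φ a b hab α hα i j hβ w with ⟨m, hm⟩ | h1
  · right; rw [hm]; exact pow_mem_pows α m
  · rcases tr_miss φ a b hab α hα p hβ' w with ⟨m, hm⟩ | h2
    · right; rw [hm]; exact pow_mem_pows α m
    · left; rw [mem_NP]; exact ⟨h1, h2⟩

lemma pows_card_fact {n : ℕ} (α : Perm (Fin n)) : (pows (⇑α)).card ≤ n.factorial := by
  classical
  refine le_trans (Finset.card_le_card ?_) (card_inj n)
  intro γ h
  obtain ⟨m, rfl⟩ := mem_pows_perm α γ h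
  simp only [Finset.mem_filter, Finset.mem_univ, true_and]
  exact (α ^ m).injective

lemma prod_le_two_pow (s : Multiset ℕ) : s.prod ≤ 2 ^ s.sum := by
  induction s using Multiset.induction with
  | empty => simp
  | cons a s ih =>
    rw [Multiset.prod_cons, Multiset.sum_cons, pow_add]
    exact Nat.mul_le_mul Nat.lt_two_pow_self.le ih

lemma pows_card_two {n : ℕ} (α : Perm (Fin n)) : (pows (⇑α)).card ≤ 2 ^ n := by
  classical
  have h1 : (pows (⇑α)).card ≤ orderOf α := by
    have : pows (⇑α) ⊆ (Finset.range (orderOf α)).image (fun m => (⇑(α ^ m) : Fin n → Fin n)) := by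
      intro γ h
      obtain ⟨m, rfl⟩ := mem_pows_perm α γ h
      rw [Finset.mem_image]
      exact ⟨m % orderOf α, Finset.mem_range.mpr (Nat.mod_lt _ (orderOf_pos α)), by rw [pow_mod_orderOf]⟩
    refine (Finset.card_le_card this).trans (Finset.card_image_le.trans ?_)
    simp
  refine h1.trans ?_
  rw [← lcm_cycleType]
  have h2 : α.cycleType.lcm ∣ α.cycleType.prod := by
    rw [Multiset.lcm_dvd]; intro b hb; exact Multiset.dvd_prod hb
  have h3 : 0 < α.cycleType.prod := by
    rw [Nat.pos_iff_ne_zero, Ne, Multiset.prod_eq_zero_iff]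
    intro h
    have := two_le_of_mem_cycleType h
    omega
  refine (Nat.le_of_dvd h3 h2).trans ((prod_le_two_pow _).trans ?_)
  apply Nat.pow_le_pow_right (by norm_num)
  rw [sum_cycleType]
  simpa using Finset.card_le_univ α.support

lemma card_NP_b3 {n : ℕ} (α : Perm (Fin n)) (i j p r : Fin n) (A : Finset (Fin n))
    (hA : ∀ x, x ∈ A ↔ α.SameCycle i x) (hj : ¬ α.SameCycle i j) (hpA : p ∉ A) (hrA : r ∉ A)
    (hr : ¬ α.SameCycle j r) (hNP : NP α i j p ⊆ V A) :
    (NP α i j p).card + (n - 1).factorial ≤ (V A).card := by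
  classical
  have hiA : i ∈ A := (hA i).mpr (SameCycle.refl _ _)
  have hir : i ≠ r := fun h => hrA (h ▸ hiA)
  let S : Perm {x : Fin n // x ≠ r} → Perm (Fin n) := fun τ => swap r p * ofSubtype τ
  have hS : ∀ τ, S τ r = p := by
    intro τ
    simp only [S, Perm.mul_apply]
    rw [ofSubtype_apply_of_not_mem τ (by simp), swap_apply_left]
  let G : Perm {x : Fin n // x ≠ r} → Fin n → Fin n := fun τ x => if x = r then S τ i else S τ x
  have hGinj : Function.Injective G := by
    intro τ τ' h
    have h1 : ofSubtype τ = ofSubtype τ' := by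
      ext x
      by_cases hx : x = r
      · subst hx; rw [ofSubtype_apply_of_not_mem τ (by simp), ofSubtype_apply_of_not_mem τ' (by simp)]
      · have := congrFun h x
        simp only [G, hx, if_false, S, Perm.mul_apply] at this
        rw [(swap r p).injective this]
    exact ofSubtype_injective h1
  let X := (Finset.univ : Finset (Perm {x : Fin n // x ≠ r})).image G
  have hX : X.card = (n - 1).factorial := by
    rw [Finset.card_image_of_injective _ hGinj, Finset.card_univ, Fintype.card_perm]
    congr 1
    rw [Fintype.card_subtype_compl, Fintype.card_fin]; simp
  have hXV : X ⊆ V A := by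
    intro γ hγ
    obtain ⟨τ, _, rfl⟩ := Finset.mem_image.mp hγ
    rw [mem_V]
    refine ⟨⟨i, hiA, r, hrA, ?_⟩, p, hpA, ?_⟩
    · simp [G]
    · intro x h
      rw [← hS τ] at h
      simp only [G] at h
      split_ifs at h with h1
      · exact hir ((S τ).injective h)
      · exact h1 ((S τ).injective h)
  have hdis : Disjoint (NP α i j p) X := by
    rw [Finset.disjoint_left]
    intro γ h1 h2
    obtain ⟨τ, _, rfl⟩ := Finset.mem_image.mp h2
    rw [mem_NP] at h1
    obtain ⟨⟨s, hs⟩, _⟩ := h1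
    have hi' : (α ^ s) i ≠ r := fun h => hrA ((hA r).mpr ⟨s, h⟩)
    have hj' : (α ^ s) j ≠ r := fun h => hr ⟨s, h⟩
    simp only [G, hi', hj', if_false] at hs
    have := (α ^ s).injective ((S τ).injective hs)
    exact hj (this ▸ SameCycle.refl _ _)
  rw [← hX, ← Finset.card_union_of_disjoint hdis]
  exact Finset.card_le_card (Finset.union_subset hNP hXV)

lemma upper3 {n : ℕ} (hp : n.Prime) (hn : 7 ≤ n) (K : ℕ)
    (hK : ∀ k, 2 ≤ k → k + 3 ≤ n → (Ukl n k).ncard ≤ K) (z : Fin n) (F : Set (Fin n))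
    (α : Perm (Fin n)) (i j p : Fin n) (hij : i ≠ j) (hpi : ¬ α.SameCycle i j → ¬ α.SameCycle i p) :
    ∃ W : Finset (Fin n → Fin n), W.card + n * (n - 1) / 2 ≤ K ∧
      ∀ f ∈ NP α i j p ∪ pows (⇑α), ∃ g ∈ W, EQ z F f g := by
  classical
  have h7 := seven_or n hp hn
  have hV2 : (V (Ak n 2)).card ≤ K := by
    have := hK 2 le_rfl (by omega)
    rw [Ukl_ncard (by norm_num) (by omega)] at this
    omega
  have hV := card_V_two hn
  have hfact := pows_card_fact α
  have hun := Finset.card_union_le (NP α i j p) (pows (⇑α))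
  have triv : (NP α i j p).card + (pows (⇑α)).card + n * (n - 1) / 2 ≤ K →
      ∃ W : Finset (Fin n → Fin n), W.card + n * (n - 1) / 2 ≤ K ∧
      ∀ f ∈ NP α i j p ∪ pows (⇑α), ∃ g ∈ W, EQ z F f g := fun h =>
    ⟨NP α i j p ∪ pows (⇑α), by omega, fun f hf => ⟨f, hf, fun _ => Iff.rfl⟩⟩
  by_cases hsc : α.SameCycle i j
  · -- case A
    apply triv
    obtain ⟨d, hd⟩ := hsc
    have h1 := card_Pσ (by omega : 2 ≤ n) (α ^ d)
    have h2 := card_compl_filter (fun γ : Fin n → Fin n => ∀ x, (α ^ d) x ≠ x → γ x ≠ γ ((α ^ d) x))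
      (NP α i j p) _ le_rfl (by
        intro γ hγ hc
        rw [mem_NP] at hγ
        obtain ⟨⟨s, hs⟩, _⟩ := hγ
        have e : (α ^ d) ((α ^ s) i) = (α ^ s) j := by
          rw [← hd, ← Perm.mul_apply, ← Perm.mul_apply, ← zpow_add, ← zpow_add, add_comm]
        apply hc ((α ^ s) i)
        · rw [e]; exact fun h => hij ((α ^ s).injective h.symm)
        · rw [e]; exact hs)
    have h3 := numA n _ h7 h1
    unfold XX at h3
    omega
  have hpi := hpi hsc
  by_cases hB1 : α i = i
  · apply triv
    have h2 := card_compl_filter (fun γ : Fin n → Fin n => ∀ y, y ≠ i → γ y ≠ γ i)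
      (NP α i j p) _ (card_alone i) (by
        intro γ hγ hc
        rw [mem_NP] at hγ
        obtain ⟨⟨s, hs⟩, _⟩ := hγ
        rw [zpow_apply_eq_self_of_apply_eq_self hB1] at hs
        refine hc ((α ^ s) j) (fun h => hsc (SameCycle.symm ⟨s, h⟩)) hs.symm)
    have h3 := numB1' n h7
    unfold XX at h3
    omega
  by_cases hB2 : α (α p) = p
  · apply triv
    have h1 : NP α i j p ⊆ (Finset.univ.filter fun γ : Fin n → Fin n => ∀ x, γ x ≠ p) ∪
        (Finset.univ.filter fun γ : Fin n → Fin n => ∀ x, γ x ≠ α p) := by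
      intro γ hγ
      rw [mem_NP] at hγ
      obtain ⟨_, s, hs⟩ := hγ
      simp only [Finset.mem_union, Finset.mem_filter, Finset.mem_univ, true_and]
      have hsq : ∀ k : ℤ, (α ^ (2 * k)) p = p := by
        intro k
        rw [zpow_mul]
        apply zpow_apply_eq_self_of_apply_eq_self
        exact hB2
      obtain ⟨k, rfl | rfl⟩ := Int.even_or_odd' s
      · left; rw [hsq] at hs; exact hs
      · right
        rw [add_comm, zpow_one_add, Perm.mul_apply, hsq] at hs; exact hs
    have h2 := (Finset.card_le_card h1).trans (Finset.card_union_le _ _)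
    have h3 := card_miss p
    have h4 := card_miss (α p)
    have h5 := numB2 n h7
    unfold XX at h5
    omega
  -- case B3
  let A : Finset (Fin n) := Finset.univ.filter fun x => α.SameCycle i x
  have hA : ∀ x, x ∈ A ↔ α.SameCycle i x := by intro x; simp [A]
  have hNP : NP α i j p ⊆ V A := by
    intro γ hγ
    rw [mem_NP] at hγ
    obtain ⟨⟨s, hs⟩, t, ht⟩ := hγ
    rw [mem_V]
    refine ⟨⟨(α ^ s) i, (hA _).mpr ⟨s, rfl⟩, (α ^ s) j, ?_, hs⟩, (α ^ t) p, ?_, ht⟩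
    · rw [hA, sameCycle_zpow_right]; exact hsc
    · rw [hA, sameCycle_zpow_right]; exact hpi
  have hA2 : 2 ≤ A.card := by
    have : ({i, α i} : Finset (Fin n)) ⊆ A := by
      intro x hx
      simp only [Finset.mem_insert, Finset.mem_singleton] at hx
      rw [hA]
      rcases hx with rfl | rfl
      · exact SameCycle.refl _ _
      · exact ⟨1, by simp⟩
    have h := Finset.card_le_card this
    rwa [Finset.card_pair (Ne.symm hB1)] at h
  have hA3 : A.card + 3 ≤ n := by
    have : ({p, α p, α (α p)} : Finset (Fin n)) ⊆ Aᶜ := by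
      intro x hx
      simp only [Finset.mem_insert, Finset.mem_singleton] at hx
      rw [Finset.mem_compl, hA]
      rcases hx with rfl | rfl | rfl
      · exact hpi
      · rw [sameCycle_apply_right]; exact hpi
      · rw [sameCycle_apply_right, sameCycle_apply_right]; exact hpi
    have h := Finset.card_le_card this
    have h1 : α p ≠ p := fun h => hB2 (by rw [h, h])
    rw [Finset.card_eq_three.mpr ⟨p, α p, α (α p), h1.symm, Ne.symm hB2, fun h => h1 (α.injective h.symm), rfl⟩,
      Finset.card_compl, Fintype.card_fin] at h
    omega
  have hco : Nat.Coprime A.card (n - A.card) := by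
    rw [Nat.coprime_sub_self_right (by omega)]
    exact (Nat.coprime_of_lt_prime (by omega) (by omega) hp).symm
  have hKA := hK A.card hA2 hA3
  rw [Ukl_ncard (by omega) (by omega)] at hKA
  have hVA := card_V_congr A (Ak n A.card) (by rw [card_Ak (by omega)])
  have hpg := card_pows_ge (n := n) (k := A.card) (by omega) (by omega) hco
  by_cases hall : ∀ x, x ∉ A → α.SameCycle j x
  · have hj : ∀ x, x ∉ A ↔ α.SameCycle j x := by
      intro x
      refine ⟨hall x, fun h h2 => hsc ?_⟩
      exact ((hA x).mp h2).trans h.symm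
    have hple := card_pows_le α A i j hA hj
    obtain ⟨W, hW, hW2⟩ := reduce (by omega : 2 ≤ n) (V A ∪ pows (⇑α))
      (fun z i j => Finset.mem_union_left _ (sing_mem_V A hA2 hA3 z i j)) z F
    have := Finset.card_union_le (V A) (pows (⇑α))
    refine ⟨W, by omega, fun f hf => hW2 f ?_⟩
    rcases Finset.mem_union.mp hf with h | h
    · exact Finset.mem_union_left _ (hNP h)
    · exact Finset.mem_union_right _ h
  · push Not at hall
    obtain ⟨r, hrA, hr⟩ := hall
    apply triv
    have h1 := card_NP_b3 α i j p r A hA hsc (by rw [hA]; exact hpi) hrA hr hNP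
    have h2 := pows_card_two α
    have h3 := numB3 n hn
    omega

lemma NP_comm {n : ℕ} (α : Perm (Fin n)) (i j p : Fin n) : NP α i j p = NP α j i p := by
  ext γ; rw [mem_NP, mem_NP]
  constructor <;> rintro ⟨⟨s, hs⟩, h⟩ <;> exact ⟨⟨s, hs.symm⟩, h⟩

lemma upper3' {n : ℕ} (hp : n.Prime) (hn : 7 ≤ n) (K : ℕ)
    (hK : ∀ k, 2 ≤ k → k + 3 ≤ n → (Ukl n k).ncard ≤ K) (z : Fin n) (F : Set (Fin n))
    (φ : Fin 2 → Fin n → Fin n) (a b : Fin 2) (hab : ∀ c, c = a ∨ c = b)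
    (ha : Function.Injective (φ a)) (hb : ¬ Function.Injective (φ b)) :
    ∃ W : Finset (Fin n → Fin n), W.card + n * (n - 1) / 2 ≤ K ∧
      ∀ w, ∃ g ∈ W, EQ z F (tr φ w) g := by
  classical
  let α : Perm (Fin n) := Equiv.ofBijective (φ a) (Finite.injective_iff_bijective.mp ha)
  have hα : φ a = α := rfl
  have hs : ¬ Function.Surjective (φ b) := fun h => hb (Finite.injective_iff_surjective.mpr h)
  simp only [Function.Injective, Function.Surjective] at hb hs
  push Not at hb hs
  obtain ⟨i, j, hβ, hij⟩ := hb
  obtain ⟨p, hpp⟩ := hs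
  have key : ∃ W : Finset (Fin n → Fin n), W.card + n * (n - 1) / 2 ≤ K ∧
      ∀ f ∈ NP α i j p ∪ pows (⇑α), ∃ g ∈ W, EQ z F f g := by
    by_cases h : ¬ α.SameCycle i j → ¬ α.SameCycle i p
    · exact upper3 hp hn K hK z F α i j p hij h
    · rw [NP_comm]
      apply upper3 hp hn K hK z F α j i p hij.symm
      push Not at h
      intro _ h2
      exact h.1 (h.2.trans h2.symm)
  obtain ⟨W, h1, h2⟩ := key
  exact ⟨W, h1, fun w => h2 _ (tr_mem φ a b hab α hα i j p hβ hpp w)⟩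

lemma upper {n : ℕ} (hp : n.Prime) (hn : 7 ≤ n) (K : ℕ)
    (hK : ∀ k, 2 ≤ k → k + 3 ≤ n → (Ukl n k).ncard ≤ K) (z : Fin n) (F : Set (Fin n))
    (φ : Fin 2 → Fin n → Fin n) :
    ∃ W : Finset (Fin n → Fin n), W.card + n * (n - 1) / 2 ≤ K ∧
      ∀ w, ∃ g ∈ W, EQ z F (tr φ w) g := by
  classical
  have h7 := seven_or n hp hn
  have hV2 : (V (Ak n 2)).card ≤ K := by
    have := hK 2 le_rfl (by omega)
    rw [Ukl_ncard (by norm_num) (by omega)] at this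
    omega
  have hV := card_V_two hn
  by_cases h0 : Function.Injective (φ 0) <;> by_cases h1 : Function.Injective (φ 1)
  · refine ⟨Finset.univ.filter fun γ => Function.Injective γ, ?_, fun w => ⟨tr φ w, ?_, fun _ => Iff.rfl⟩⟩
    · have := card_inj n
      have h5 := numII n h7
      unfold XX at h5
      omega
    · simp only [Finset.mem_filter, Finset.mem_univ, true_and]
      induction w with
      | nil => exact Function.injective_id
      | cons c w ih =>
        rw [tr_cons]
        apply ih.comp
        fin_cases c
        · exact h0
        · exact h1
  · exact upper3' hp hn K hK z F φ 0 1 (by decide) h0 h1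
  · exact upper3' hp hn K hK z F φ 1 0 (by decide) h1 h0
  · simp only [Function.Injective] at h0 h1
    push Not at h0 h1
    obtain ⟨i, j, hβ, hij⟩ := h0
    obtain ⟨i', j', hβ', hij'⟩ := h1
    let S1 := Finset.univ.filter fun γ : Fin n → Fin n => γ i = γ j
    let S2 := Finset.univ.filter fun γ : Fin n → Fin n => γ i' = γ j'
    refine ⟨{id} ∪ (S1 ∪ S2), ?_, fun w => ⟨tr φ w, ?_, fun _ => Iff.rfl⟩⟩
    · have e1 := Finset.card_union_le {id} (S1 ∪ S2)
      have e2 := Finset.card_union_le S1 S2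
      have e3 : S1.card ≤ _ := card_eq_pair i j hij
      have e4 : S2.card ≤ _ := card_eq_pair i' j' hij'
      have h5 := numI n h7
      unfold XX at h5
      rw [Finset.card_singleton] at e1
      omega
    · cases w with
      | nil => simp [tr_nil]
      | cons c w =>
        rw [tr_cons]
        simp only [Finset.mem_union, S1, S2, Finset.mem_filter, Finset.mem_univ, true_and, Function.comp]
        right
        fin_cases c
        · left; exact congrArg _ hβ
        · right; exact congrArg _ hβ'

end Cor

namespace Cor

open Equiv Equiv.Perm

lemma upper_lang {n : ℕ} (hp : n.Prime) (hn : 7 ≤ n) (K : ℕ)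
    (hK : ∀ k, 2 ≤ k → k + 3 ≤ n → (Ukl n k).ncard ≤ K) (L : Language (Fin 2)) (hL : IsReg L)
    (hs : sc L ≤ n) : sc (root L) + n * (n - 1) / 2 ≤ K := by
  obtain ⟨M, rfl⟩ := exists_dfa L hL hs
  obtain ⟨W, h1, h2⟩ := upper hp hn K hK M.start M.accept (fun a q => M.step q a)
  have := (sc_root_le M W h2).1
  omega

lemma lower_lang {n : ℕ} (hn : 7 ≤ n) (k : ℕ) (hk : 2 ≤ k) (hk3 : k + 3 ≤ n) (hco : Nat.Coprime k (n - k)) :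
    ∃ L : Language (Fin 2), IsReg L ∧ sc L ≤ n ∧ (Ukl n k).ncard ≤ sc (root L) + n * (n - 1) / 2 := by
  classical
  let α : Perm (Fin n) := Equiv.ofBijective (twoCycle n k)
    (Finite.injective_iff_bijective.mp (twoCycle_inj (by omega) (by omega)))
  have hα : (⇑α : Fin n → Fin n) = twoCycle n k := rfl
  have hAc : (Ak n k).card = k := card_Ak (by omega)
  obtain ⟨β, hβ⟩ := gen (Ak n k) (by omega) (by omega) α (by
    intro i hi i' hi' j hj j' hj'
    rw [mem_Ak] at hi hi' hj hj'
    obtain ⟨m, _, h1, h2⟩ := twoCycle_trans (by omega) (by omega) hco i i' j j' hi hi' (by omega) (by omega)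
    exact ⟨m, by rw [Equiv.Perm.coe_pow]; exact h1, by rw [Equiv.Perm.coe_pow]; exact h2⟩)
  let z : Fin n := ⟨0, by omega⟩
  let M : DFA (Fin 2) (Fin n) := ⟨fun q a => if a = 0 then α q else β q, z, {z}⟩
  let T : Set (Fin n → Fin n) := {f | ∃ w, tr (fun a q => M.step q a) w = f}
  have hcomp : ∀ f ∈ T, ∀ g ∈ T, f ∘ g ∈ T := by
    rintro f ⟨w, rfl⟩ g ⟨v, rfl⟩
    exact ⟨v ++ w, tr_append _ _ _⟩
  have hαT : (⇑α : Fin n → Fin n) ∈ T := ⟨[0], rfl⟩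
  have hβT : β ∈ T := ⟨[1], rfl⟩
  have hidT : id ∈ T := ⟨[], rfl⟩
  have hVT := hβ T hcomp hαT hβT hidT
  have hpT : ∀ f ∈ pows (twoCycle n k), f ∈ T := by
    intro f hf
    rw [mem_pows] at hf
    obtain ⟨m, _, rfl⟩ := hf
    clear * - hcomp hαT hidT hα
    induction m with
    | zero => exact hidT
    | succ m ih => rw [Function.iterate_succ]; exact hcomp _ ih _ hαT
  have hsV := sing_mem_V (Ak n k) (by omega) (by omega)
  let S : Finset (Fin n → Fin n) := (prs n).image fun p => sing z p.1 p.2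
  have hScard : S.card ≤ n * (n - 1) / 2 := by
    rw [← card_prs]; exact Finset.card_image_le
  let R := (V (Ak n k) ∪ pows (twoCycle n k)) \ S
  have hR : R.card ≤ sc (root M.accepts) := by
    apply sc_root_ge M R
    · intro f hf
      rcases Finset.mem_union.mp (Finset.mem_sdiff.mp hf).1 with h | h
      · exact hVT f h
      · exact hpT f h
    · intro f hf g hg hfg
      have hf2 := (Finset.mem_sdiff.mp hf).2
      have hg2 := (Finset.mem_sdiff.mp hg).2
      obtain ⟨y, a, b, h⟩ := disting z f g hfg (by
        rintro i j ⟨rfl, rfl⟩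
        rcases lt_trichotomy i j with h | h | h
        · exact hf2 (Finset.mem_image.mpr ⟨(i, j), by simp [prs, h], rfl⟩)
        · subst h; exact hfg rfl
        · exact hg2 (Finset.mem_image.mpr ⟨(j, i), by simp [prs, h], rfl⟩))
      obtain ⟨v, hv⟩ := hVT _ (hsV y a b)
      refine ⟨v, ?_⟩
      rw [hv]
      exact h
  have hU : (Ukl n k).ncard = (V (Ak n k) ∪ pows (twoCycle n k)).card := by
    rw [Ukl_eq (by omega) (by omega), Set.ncard_coe_finset]
  refine ⟨M.accepts, ⟨Fin n, inferInstance, M, rfl⟩, by simpa using sc_le_of_dfa M, ?_⟩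
  have := Finset.le_card_sdiff S (V (Ak n k) ∪ pows (twoCycle n k))
  have h3 : R.card = ((V (Ak n k) ∪ pows (twoCycle n k)) \ S).card := rfl
  omega

end Cor

/-- **Corollary 3.21.** For every prime `n ≥ 7` there are coprime `k ≥ 2`, `l ≥ 3`
with `k + l = n` such that every regular language `L` over a two-letter alphabet with
`sc L ≤ n` has `sc (root L) ≤ |U_{k,l}| - n(n-1)/2`, and this bound is attained. -/
theorem corollary_3_21 (n : ℕ) (hp : n.Prime) (hn : 7 ≤ n) :
    ∃ k l : ℕ, 2 ≤ k ∧ 3 ≤ l ∧ Nat.Coprime k l ∧ k + l = n ∧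
      (∀ L : Language (Fin 2), IsReg L → sc L ≤ n →
        sc (root L) + n * (n - 1) / 2 ≤ (Ukl n k).ncard) ∧
      ∃ L : Language (Fin 2), IsReg L ∧ sc L ≤ n ∧
        sc (root L) + n * (n - 1) / 2 = (Ukl n k).ncard := by
  obtain ⟨k, hk, hmax⟩ := Finset.exists_max_image (Finset.Icc 2 (n - 3)) (fun k => (Ukl n k).ncard)
    ⟨2, Finset.mem_Icc.mpr ⟨le_rfl, by omega⟩⟩
  rw [Finset.mem_Icc] at hk
  have hK : ∀ k', 2 ≤ k' → k' + 3 ≤ n → (Ukl n k').ncard ≤ (Ukl n k).ncard := fun k' h1 h2 =>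
    hmax k' (Finset.mem_Icc.mpr ⟨h1, by omega⟩)
  have hco : Nat.Coprime k (n - k) := by
    rw [Nat.coprime_sub_self_right (by omega)]
    exact (Nat.coprime_of_lt_prime (by omega) (by omega) hp).symm
  have hup := Cor.upper_lang hp hn _ hK
  refine ⟨k, n - k, hk.1, by omega, hco, by omega, hup, ?_⟩
  obtain ⟨L, h1, h2, h3⟩ := Cor.lower_lang hn k hk.1 (by omega) hco
  exact ⟨L, h1, h2, le_antisymm (hup L h1 h2) h3⟩
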